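/- arXiv:2005.04227 — 3 statements merged into one kernel-verified Lean document; each statement's English description precedes it below -/
import Mathlib

section
/- The integral ∫_0^∞ 1 / ((v²+1) cosh(πv/4)) dv equals (ψ(7/8) - ψ(3/8))/2. -/
open MeasureTheory

/-- The digamma function, the logarithmic derivative of the Gamma function. -/
noncomputable def digamma (x : ℝ) : ℝ := deriv (fun y : ℝ => Real.log (Real.Gamma y)) x

open Filter Topology

lemma differentiableAt_log_Gamma {x : ℝ} (hx : 0 < x) :
    DifferentiableAt ℝ (fun y : ℝ => Real.log (Real.Gamma y)) x :=
  (Real.differentiableAt_Gamma fun m => by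
    have : (0 : ℝ) ≤ m := m.cast_nonneg
    linarith).log (Real.Gamma_pos_of_pos hx).ne'

lemma digamma_add_one {x : ℝ} (hx : 0 < x) : digamma (x + 1) = digamma x + 1 / x := by
  have h1 : deriv (fun y : ℝ => Real.log (Real.Gamma (y + 1))) x = digamma (x + 1) :=
    deriv_comp_add_const (f := fun y : ℝ => Real.log (Real.Gamma y)) 1 x
  have h2 : (fun y : ℝ => Real.log (Real.Gamma (y + 1))) =ᶠ[𝓝 x]
      fun y => Real.log (Real.Gamma y) + Real.log y := by
    filter_upwards [eventually_gt_nhds hx] with y hy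
    rw [Real.Gamma_add_one hy.ne', Real.log_mul hy.ne' (Real.Gamma_pos_of_pos hy).ne', add_comm]
  rw [← h1, h2.deriv_eq, deriv_fun_add (differentiableAt_log_Gamma hx)
    (Real.differentiableAt_log hx.ne'), Real.deriv_log, digamma, one_div]

lemma digamma_add_natCast {x : ℝ} (hx : 0 < x) (N : ℕ) :
    digamma (x + N) = digamma x + ∑ n ∈ Finset.range N, 1 / (x + n) := by
  induction N with
  | zero => simp
  | succ N ih =>
    rw [Finset.sum_range_succ, ← add_assoc, ← ih, ← digamma_add_one (by positivity)]
    push_cast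
    ring_nf

lemma monotoneOn_digamma : MonotoneOn digamma (Set.Ioi 0) :=
  Real.convexOn_log_Gamma.monotoneOn_deriv fun _ hx => differentiableAt_log_Gamma hx

lemma tendsto_sum_digamma_sub {x y : ℝ} (hx : 0 < x) (hxy : x ≤ y) (hyx : y ≤ x + 1) :
    Tendsto (fun N : ℕ => ∑ n ∈ Finset.range N, (1 / (x + n) - 1 / (y + n))) atTop
      (𝓝 (digamma y - digamma x)) := by
  have hy : 0 < y := hx.trans_le hxy
  have hlim : Tendsto (fun N : ℕ => digamma (y + N) - digamma (x + N)) atTop (𝓝 0) := by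
    have hinv : Tendsto (fun N : ℕ => 1 / (x + (N : ℝ))) atTop (𝓝 0) := by
      simp_rw [one_div]
      exact (tendsto_atTop_add_const_left _ x tendsto_natCast_atTop_atTop).inv_tendsto_atTop
    refine squeeze_zero (fun N => ?_) (fun N => ?_) hinv
    · have hN : (0 : ℝ) ≤ N := N.cast_nonneg
      exact sub_nonneg.2 (monotoneOn_digamma (Set.mem_Ioi.2 (by linarith))
        (Set.mem_Ioi.2 (by linarith)) (by linarith))
    · have hN : (0 : ℝ) ≤ N := N.cast_nonneg
      have hle : digamma (y + N) ≤ digamma (x + N + 1) := monotoneOn_digamma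
        (Set.mem_Ioi.2 (by linarith)) (Set.mem_Ioi.2 (by linarith)) (by linarith)
      rw [digamma_add_one (by positivity)] at hle
      linarith
  have := hlim.const_sub (digamma y - digamma x)
  rw [sub_zero] at this
  refine this.congr fun N => ?_
  rw [digamma_add_natCast hx, digamma_add_natCast hy, Finset.sum_sub_distrib]
  ring

lemma integrable_inv_sq_add_sq {b : ℝ} (hb : 0 < b) :
    Integrable fun v : ℝ => (b ^ 2 + v ^ 2)⁻¹ := by
  have h := (integrable_inv_one_add_sq.comp_mul_left' (inv_ne_zero hb.ne')).const_mul (b ^ 2)⁻¹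
  refine h.congr (.of_forall fun v => ?_)
  have : b ^ 2 + v ^ 2 ≠ 0 := by positivity
  simp only
  field_simp

lemma integral_Ioi_inv_sq_add_sq {b : ℝ} (hb : 0 < b) :
    ∫ v in Set.Ioi (0 : ℝ), (b ^ 2 + v ^ 2)⁻¹ = Real.pi / (2 * b) := by
  have h := integral_comp_mul_left_Ioi (fun v : ℝ => (1 + v ^ 2)⁻¹) 0 (inv_pos.2 hb)
  rw [mul_zero, integral_Ioi_inv_one_add_sq, Real.arctan_zero, smul_eq_mul, inv_inv] at h
  have h2 : ∀ v : ℝ, (b ^ 2 + v ^ 2)⁻¹ = (b ^ 2)⁻¹ * (1 + (b⁻¹ * v) ^ 2)⁻¹ := fun v => by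
    have : b ^ 2 + v ^ 2 ≠ 0 := by positivity
    field_simp
  simp_rw [h2]
  rw [integral_const_mul, h]
  field_simp
  ring

lemma div_mul_eq_partialFraction {b : ℝ} (hb : 1 < b) (v : ℝ) :
    1 / (v ^ 2 + 1) * (b / (b ^ 2 + v ^ 2)) =
      b / (b ^ 2 - 1) * ((1 ^ 2 + v ^ 2)⁻¹ - (b ^ 2 + v ^ 2)⁻¹) := by
  have h1 : v ^ 2 + 1 ≠ 0 := by positivity
  have h2 : b ^ 2 + v ^ 2 ≠ 0 := by positivity
  have h3 : b ^ 2 - 1 ≠ 0 := by nlinarith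
  have h4 : 1 ^ 2 + v ^ 2 ≠ 0 := by positivity
  field_simp
  ring

lemma integrable_div_mul {b : ℝ} (hb : 1 < b) :
    Integrable fun v : ℝ => 1 / (v ^ 2 + 1) * (b / (b ^ 2 + v ^ 2)) := by
  simp_rw [div_mul_eq_partialFraction hb]
  exact ((integrable_inv_sq_add_sq one_pos).sub
    (integrable_inv_sq_add_sq (one_pos.trans hb))).const_mul _

lemma integral_Ioi_div_mul {b : ℝ} (hb : 1 < b) :
    ∫ v in Set.Ioi (0 : ℝ), 1 / (v ^ 2 + 1) * (b / (b ^ 2 + v ^ 2)) =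
      Real.pi / 2 * (1 / (b + 1)) := by
  have hb0 : 0 < b := one_pos.trans hb
  simp_rw [div_mul_eq_partialFraction hb]
  rw [integral_const_mul, integral_sub (integrable_inv_sq_add_sq one_pos).integrableOn
    (integrable_inv_sq_add_sq hb0).integrableOn, integral_Ioi_inv_sq_add_sq one_pos,
    integral_Ioi_inv_sq_add_sq hb0]
  have h3 : b ^ 2 - 1 ≠ 0 := by nlinarith
  field_simp
  ring

lemma Complex.hasSum_cotTerm {x : ℂ} (hx : x ∈ Complex.integerComplement) :
    HasSum (fun n : ℕ => 1 / (x - (n + 1)) + 1 / (x + (n + 1)))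
      (Real.pi * Complex.cot (Real.pi * x) - 1 / x) := by
  rw [cot_series_rep' hx]
  exact (summable_cotTerm hx).hasSum

lemma Complex.mem_integerComplement_of_re {x : ℂ} (hx : x.re = 1 / 4) :
    x ∈ Complex.integerComplement := by
  rintro ⟨n, rfl⟩
  rw [Complex.intCast_re] at hx
  have h : ((4 * n : ℤ) : ℝ) = (1 : ℤ) := by push_cast; linarith
  have := Int.cast_injective h
  omega

lemma Complex.cot_add_cot (z : ℂ) (hz : Complex.cos (2 * z) ≠ 0) :
    Complex.cot (Real.pi / 4 - z) + Complex.cot (Real.pi / 4 + z) = 2 / Complex.cos (2 * z) := by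
  have hs : Complex.sin (Real.pi / 4) = Complex.cos (Real.pi / 4) := by
    rw [← Complex.cos_pi_div_two_sub]; congr 1; ring
  have h1 := Complex.sin_sq_add_cos_sq (Real.pi / 4 : ℂ)
  have h2 := Complex.cos_two_mul z
  have h3 := Complex.sin_sq_add_cos_sq z
  have hc : Complex.cos (Real.pi / 4) ^ 2 = 1 / 2 := by rw [hs] at h1; linear_combination h1 / 2
  have hp : Complex.sin (Real.pi / 4 - z) * Complex.sin (Real.pi / 4 + z) =
      Complex.cos (2 * z) / 2 := by
    rw [Complex.sin_sub, Complex.sin_add, hs, h2]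
    linear_combination (Complex.cos z ^ 2 - Complex.sin z ^ 2) * hc - h3 / 2
  have hp0 := div_ne_zero hz two_ne_zero
  rw [← hp] at hp0
  have ha := left_ne_zero_of_mul hp0
  have hb := right_ne_zero_of_mul hp0
  have hn : Complex.sin (Real.pi / 4 + z) * Complex.cos (Real.pi / 4 - z) +
      Complex.cos (Real.pi / 4 + z) * Complex.sin (Real.pi / 4 - z) = 1 := by
    rw [← Complex.sin_add, ← Complex.sin_pi_div_two]; congr 1; ring
  have hz2 : Complex.cos (2 * z) =
    2 * (Complex.sin (Real.pi / 4 - z) * Complex.sin (Real.pi / 4 + z)) := by rw [hp]; ring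
  rw [Complex.cot, Complex.cot, hz2, div_add_div _ _ ha hb,
    div_eq_div_iff hp0 (mul_ne_zero two_ne_zero hp0)]
  linear_combination
    (2 * (Complex.sin (Real.pi / 4 - z) * Complex.sin (Real.pi / 4 + z))) * hn

/-- The Mittag-Leffler expansion of the hyperbolic secant, with consecutive terms paired. -/
lemma hasSum_sech (v : ℝ) :
    HasSum (fun n : ℕ => (8 * n + 10 : ℝ) / ((8 * n + 10) ^ 2 + v ^ 2) -
      (8 * n + 6) / ((8 * n + 6) ^ 2 + v ^ 2))
      (Real.pi / 8 * (1 / Real.cosh (Real.pi * v / 4)) - 2 / (2 ^ 2 + v ^ 2)) := by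
  have hxm : (1 / 4 - Complex.I * v / 8 : ℂ).re = 1 / 4 := by simp
  have hxp : (1 / 4 + Complex.I * v / 8 : ℂ).re = 1 / 4 := by simp
  have h := ((Complex.hasSum_cotTerm (Complex.mem_integerComplement_of_re hxm)).add
    (Complex.hasSum_cotTerm (Complex.mem_integerComplement_of_re hxp))).mul_left (1 / 16)
  have hinv : ∀ a : ℝ, a ≠ 0 → 1 / (a / 8 - Complex.I * v / 8 : ℂ) + 1 / (a / 8 + Complex.I * v / 8)
      = 16 * ((a / (a ^ 2 + v ^ 2) : ℝ) : ℂ) := by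
    intro a ha
    have h0 : (a ^ 2 + v ^ 2 : ℂ) ≠ 0 := by
      have : a ^ 2 + v ^ 2 ≠ 0 := by positivity
      exact_mod_cast this
    have hm : (a - Complex.I * v : ℂ) ≠ 0 := fun h => ha (by simpa using congrArg Complex.re h)
    have hp : (a + Complex.I * v : ℂ) ≠ 0 := fun h => ha (by simpa using congrArg Complex.re h)
    push_cast
    rw [← sub_div, ← add_div]
    field_simp
    linear_combination (16 * (a : ℂ) * v ^ 2) * Complex.I_sq
  have hcosh : Complex.cos (2 * (Complex.I * (Real.pi * v / 8))) =
      (Real.cosh (Real.pi * v / 4) : ℂ) := by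
    push_cast
    rw [← Complex.cos_mul_I]
    congr 1
    ring
  have hcosh0 : (Real.cosh (Real.pi * v / 4) : ℂ) ≠ 0 :=
    Complex.ofReal_ne_zero.2 (Real.cosh_pos _).ne'
  have hcot := Complex.cot_add_cot (Complex.I * (Real.pi * v / 8)) (by rw [hcosh]; exact hcosh0)
  rw [hcosh] at hcot
  refine Complex.hasSum_ofReal.1 ?_
  convert h using 1
  · rfl
  · funext n
    have e1 := hinv (8 * n + 10) (by positivity)
    have e2 := hinv (8 * n + 6) (by positivity)
    have e3 : ∀ x : ℂ, 1 / x = -(1 / (-x)) := fun x => by rw [one_div_neg_eq_neg_one_div, neg_neg]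
    rw [e3 (1 / 4 - Complex.I * v / 8 - (n + 1)), e3 (1 / 4 + Complex.I * v / 8 - (n + 1))]
    rw [Complex.ofReal_sub]
    have f1 : (1 / 4 - Complex.I * v / 8 + (n + 1) : ℂ) =
      (8 * n + 10 : ℝ) / 8 - Complex.I * v / 8 := by push_cast; ring
    have f2 : (1 / 4 + Complex.I * v / 8 + (n + 1) : ℂ) =
      (8 * n + 10 : ℝ) / 8 + Complex.I * v / 8 := by push_cast; ring
    have f3 : -(1 / 4 - Complex.I * v / 8 - (n + 1) : ℂ) =
      (8 * n + 6 : ℝ) / 8 + Complex.I * v / 8 := by push_cast; ring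
    have f4 : -(1 / 4 + Complex.I * v / 8 - (n + 1) : ℂ) =
      (8 * n + 6 : ℝ) / 8 - Complex.I * v / 8 := by push_cast; ring
    rw [f1, f2, f3, f4]
    linear_combination (-1 / 16) * e1 + (1 / 16) * e2
  · have e := hinv 2 two_ne_zero
    have f1 : (Real.pi * (1 / 4 - Complex.I * v / 8) : ℂ) =
      Real.pi / 4 - Complex.I * (Real.pi * v / 8) := by ring
    have f2 : (Real.pi * (1 / 4 + Complex.I * v / 8) : ℂ) =
      Real.pi / 4 + Complex.I * (Real.pi * v / 8) := by ring
    have f3 : (1 / 4 : ℂ) = (2 : ℝ) / 8 := by push_cast; norm_num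
    rw [f1, f2, f3]
    rw [Complex.ofReal_sub, Complex.ofReal_mul, Complex.ofReal_div, Complex.ofReal_div 1]
    push_cast at e hcot ⊢
    linear_combination (1 / 16) * e - (Real.pi / 16 : ℂ) * hcot

lemma abs_div_sub_div_le {b c : ℝ} (hb : 0 < b) (hbc : b ≤ c) (v : ℝ) :
    |c / (c ^ 2 + v ^ 2) - b / (b ^ 2 + v ^ 2)| ≤ (c - b) / b ^ 2 := by
  have hc : 0 < c := hb.trans_le hbc
  have hB : 0 < b ^ 2 + v ^ 2 := by positivity
  have hC : 0 < c ^ 2 + v ^ 2 := by positivity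
  have h1 : c / (c ^ 2 + v ^ 2) - b / (b ^ 2 + v ^ 2) =
      (c - b) / (b ^ 2 + v ^ 2) * ((v ^ 2 - b * c) / (c ^ 2 + v ^ 2)) := by
    field_simp
    ring
  have h2 : |(v ^ 2 - b * c) / (c ^ 2 + v ^ 2)| ≤ 1 := by
    rw [abs_div, abs_of_pos hC, div_le_one hC, abs_le]
    constructor <;> nlinarith [mul_pos hb hc, sq_nonneg v]
  have h3 : (c - b) / (b ^ 2 + v ^ 2) ≤ (c - b) / b ^ 2 := by
    have : 0 ≤ c - b := sub_nonneg.2 hbc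
    gcongr
    nlinarith
  have h4 : 0 ≤ (c - b) / (b ^ 2 + v ^ 2) := div_nonneg (sub_nonneg.2 hbc) hB.le
  rw [h1, abs_mul, abs_of_nonneg h4]
  nlinarith

lemma hasSum_integral_sech :
    HasSum (fun n : ℕ => Real.pi / 2 * (1 / (8 * n + 11) - 1 / (8 * n + 7)))
      (Real.pi / 8 * (∫ v in Set.Ioi (0 : ℝ), 1 / ((v ^ 2 + 1) * Real.cosh (Real.pi * v / 4))) -
        Real.pi / 6) := by
  set F : ℕ → ℝ → ℝ := fun n v => 1 / (v ^ 2 + 1) * ((8 * n + 10 : ℝ) / ((8 * n + 10) ^ 2 + v ^ 2)) -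
      1 / (v ^ 2 + 1) * ((8 * n + 6) / ((8 * n + 6) ^ 2 + v ^ 2)) with hF
  have hn : ∀ n : ℕ, (0 : ℝ) ≤ n := fun n => n.cast_nonneg
  have h10 : ∀ n : ℕ, (1 : ℝ) < 8 * n + 10 := fun n => by linarith [hn n]
  have h6 : ∀ n : ℕ, (1 : ℝ) < 8 * n + 6 := fun n => by linarith [hn n]
  have hint : ∀ n, IntegrableOn (F n) (Set.Ioi 0) := fun n =>
    ((integrable_div_mul (h10 n)).sub (integrable_div_mul (h6 n))).integrableOn
  have hbase : IntegrableOn (fun v : ℝ => (1 ^ 2 + v ^ 2)⁻¹) (Set.Ioi 0) :=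
    (integrable_inv_sq_add_sq one_pos).integrableOn
  have hbound : ∀ n v, ‖F n v‖ ≤ 4 / (8 * n + 6) ^ 2 * (1 ^ 2 + v ^ 2)⁻¹ := by
    intro n v
    have hle := abs_div_sub_div_le (b := 8 * n + 6) (c := 8 * n + 10) (by linarith [hn n])
      (by linarith) v
    have hpos : 0 < 1 / (v ^ 2 + 1) := by positivity
    rw [hF, Real.norm_eq_abs]
    simp only
    rw [← mul_sub, abs_mul, abs_of_pos hpos, mul_comm, one_pow, add_comm 1, one_div]
    gcongr
    exact hle.trans_eq (by ring)
  have hsum : Summable fun n : ℕ => ∫ v in Set.Ioi (0 : ℝ), ‖F n v‖ := by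
    have hs : Summable fun n : ℕ => (4 : ℝ) / (8 * n + 6) ^ 2 * (Real.pi / 2) := by
      refine Summable.mul_right _ (Summable.of_nonneg_of_le (fun n => by positivity) (fun n => ?_)
        ((summable_nat_add_iff 1).2 (Real.summable_one_div_nat_pow.2 one_lt_two)))
      rw [div_le_div_iff₀ (by positivity) (by positivity)]
      push_cast
      nlinarith [hn n]
    refine Summable.of_nonneg_of_le (fun n => integral_nonneg fun v => norm_nonneg _) (fun n : ℕ => ?_) hs
    calc ∫ v in Set.Ioi (0 : ℝ), ‖F n v‖
        ≤ ∫ v in Set.Ioi (0 : ℝ), 4 / (8 * (n : ℝ) + 6) ^ 2 * (1 ^ 2 + v ^ 2)⁻¹ :=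
          integral_mono (hint n).norm (hbase.const_mul _) (hbound n)
      _ = _ := by rw [integral_const_mul, integral_Ioi_inv_sq_add_sq one_pos, mul_one]
  have htsum : ∀ v, ∑' n, F n v = Real.pi / 8 * (1 / ((v ^ 2 + 1) * Real.cosh (Real.pi * v / 4))) -
      1 / (v ^ 2 + 1) * (2 / (2 ^ 2 + v ^ 2)) := by
    intro v
    have h := (hasSum_sech v).mul_left (1 / (v ^ 2 + 1))
    simp_rw [mul_sub] at h
    rw [h.tsum_eq, one_div_mul_eq_div (v ^ 2 + 1)]
    field_simp
  have hcosh : IntegrableOn (fun v : ℝ => 1 / ((v ^ 2 + 1) * Real.cosh (Real.pi * v / 4)))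
      (Set.Ioi 0) := by
    refine hbase.mono' ?_ (.of_forall fun v => ?_)
    · refine Continuous.aestronglyMeasurable (continuous_const.div (by fun_prop) fun v => ?_)
      have := Real.cosh_pos (Real.pi * v / 4)
      positivity
    · have h1 := Real.one_le_cosh (Real.pi * v / 4)
      have h2 : 0 < v ^ 2 + 1 := by positivity
      rw [Real.norm_of_nonneg (by positivity), one_pow, add_comm 1, ← one_div]
      exact one_div_le_one_div_of_le h2 (le_mul_of_one_le_right h2.le h1)
  have h := hasSum_integral_of_summable_integral_norm hint hsum
  simp_rw [htsum] at h
  rw [integral_sub (hcosh.const_mul _) (integrable_div_mul one_lt_two).integrableOn,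
    integral_const_mul, integral_Ioi_div_mul one_lt_two] at h
  convert h using 1
  · rfl
  · funext n
    simp only [hF]
    rw [integral_sub (integrable_div_mul (h10 n)).integrableOn
      (integrable_div_mul (h6 n)).integrableOn, integral_Ioi_div_mul (h10 n),
      integral_Ioi_div_mul (h6 n)]
    ring_nf
  · ring

/-- `∫_0^∞ dv / ((v²+1) cosh(πv/4)) = (ψ(7/8) - ψ(3/8)) / 2`. -/
theorem integral_inv_sq_cosh :
    ∫ v in Set.Ioi (0 : ℝ), 1 / ((v ^ 2 + 1) * Real.cosh (Real.pi * v / 4)) =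
      (digamma (7 / 8) - digamma (3 / 8)) / 2 := by
  have h1 := hasSum_integral_sech.tendsto_sum_nat
  have h2 := tendsto_sum_digamma_sub (x := 3 / 8) (y := 7 / 8) (by norm_num) (by norm_num)
    (by norm_num)
  have h3 : Tendsto (fun N : ℕ => 1 / (8 * (N : ℝ) + 3)) atTop (𝓝 0) := by
    simp_rw [one_div]
    exact (tendsto_atTop_add_const_right _ 3
      (tendsto_natCast_atTop_atTop.const_mul_atTop (by norm_num : (0 : ℝ) < 8))).inv_tendsto_atTop
  have h4 := (((h2.div_const 8).add h3).sub_const (1 / 3)).const_mul (Real.pi / 2)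
  have hpartial : ∀ N : ℕ, Real.pi / 2 * ((∑ n ∈ Finset.range N,
      (1 / (3 / 8 + (n : ℝ)) - 1 / (7 / 8 + n))) / 8 + 1 / (8 * N + 3) - 1 / 3) =
      ∑ n ∈ Finset.range N, Real.pi / 2 * (1 / (8 * (n : ℝ) + 11) - 1 / (8 * n + 7)) := by
    intro N
    induction N with
    | zero => simp
    | succ N ih =>
      rw [Finset.sum_range_succ, Finset.sum_range_succ, ← ih]
      have e1 : 1 / (3 / 8 + (N : ℝ)) = 8 * (1 / (8 * N + 3)) := by field_simp; ring
      have e2 : 1 / (7 / 8 + (N : ℝ)) = 8 * (1 / (8 * N + 7)) := by field_simp; ring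
      have e3 : 8 * ((N + 1 : ℕ) : ℝ) + 3 = 8 * N + 11 := by push_cast; ring
      rw [e1, e2, e3]
      ring
  have h5 := tendsto_nhds_unique h1 (h4.congr hpartial)
  refine mul_left_cancel₀ (div_ne_zero Real.pi_ne_zero (by norm_num : (8 : ℝ) ≠ 0)) ?_
  linear_combination h5
end

section
/- For real a > 0, ∫_0^∞ log(a² + 4v²) / cosh(πv) dv = 2 log 2 - 2 log Γ(a/4 + 1/4) + 2 log Γ(a/4 + 3/4). -/
open MeasureTheory Filter Topology

lemma one_add_abs_div_cosh_pi_mul_le (x : ℝ) :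
    (1 + |x|) / Real.cosh (Real.pi * x) ≤ 4 * (1 + x ^ 2)⁻¹ := by
  have hx := abs_nonneg x
  have h1 : 1 + |x| ≤ Real.exp |x| := by linarith [Real.add_one_le_exp |x|]
  have h2 : 1 + x ^ 2 ≤ 2 * Real.exp |x| := by
    have := Real.quadratic_le_exp_of_nonneg hx
    rw [sq_abs] at this
    linarith
  have h3 : Real.exp |x| * Real.exp |x| ≤ Real.exp (Real.pi * |x|) := by
    rw [← Real.exp_add]
    apply Real.exp_le_exp.2
    nlinarith [Real.pi_gt_three]
  have h4 : Real.exp (Real.pi * |x|) ≤ 2 * Real.cosh (Real.pi * x) := by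
    rw [← Real.cosh_abs (Real.pi * x), abs_mul, abs_of_pos Real.pi_pos, Real.cosh_eq]
    linarith [Real.exp_pos (-(Real.pi * |x|))]
  rw [← div_eq_mul_inv, div_le_div_iff₀ (Real.cosh_pos _) (by positivity)]
  have h5 : (1 + |x|) * (1 + x ^ 2) ≤ Real.exp |x| * (2 * Real.exp |x|) :=
    mul_le_mul h1 h2 (by positivity) (by positivity)
  linarith

lemma integrable_inv_cosh_pi_mul_smul {E : Type*} [NormedAddCommGroup E] [NormedSpace ℝ E]
    {g : ℝ → E} (hg : Continuous g) {C : ℝ} (hC : ∀ x, ‖g x‖ ≤ C * (1 + |x|)) :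
    Integrable fun x : ℝ => (Real.cosh (Real.pi * x))⁻¹ • g x := by
  have hC0 : 0 ≤ C := by simpa using (norm_nonneg _).trans (hC 0)
  refine (integrable_inv_one_add_sq.const_mul (C * 4)).mono' ?_ (ae_of_all _ fun x => ?_)
  · refine Continuous.aestronglyMeasurable (Continuous.smul (Continuous.inv₀ ?_ ?_) hg)
    · fun_prop
    · exact fun x => (Real.cosh_pos _).ne'
  · rw [norm_smul, norm_inv, Real.norm_of_nonneg (Real.cosh_pos _).le]
    have h := mul_le_mul_of_nonneg_left (one_add_abs_div_cosh_pi_mul_le x) hC0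
    have h' := mul_le_mul_of_nonneg_left (hC x) (inv_nonneg.2 (Real.cosh_pos (Real.pi * x)).le)
    refine h'.trans (le_trans (le_of_eq ?_) (h.trans (le_of_eq ?_))) <;> ring

lemma integrable_inv_cosh_pi_mul : Integrable fun x : ℝ => (Real.cosh (Real.pi * x))⁻¹ := by
  simpa using integrable_inv_cosh_pi_mul_smul (g := fun _ => (1 : ℝ)) continuous_const (C := 1)
    (fun x => by simp)

lemma integral_inv_cosh_pi_mul : ∫ x : ℝ, (Real.cosh (Real.pi * x))⁻¹ = 1 := by
  have hd : ∀ x : ℝ, HasDerivAt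
      (fun x => 2 / Real.pi * Real.arctan (Real.exp (Real.pi * x)))
      (Real.cosh (Real.pi * x))⁻¹ x := by
    intro x
    have h := (((hasDerivAt_id x).const_mul Real.pi).exp.arctan).const_mul (2 / Real.pi)
    convert! h using 1
    have := Real.pi_ne_zero
    have he := Real.exp_pos (Real.pi * x)
    simp only [id, Real.cosh_eq, Real.exp_neg]
    field_simp
    ring
  have hbot : Tendsto (fun x : ℝ => Real.pi * x) atBot atBot :=
    tendsto_id.const_mul_atBot Real.pi_pos
  have htop : Tendsto (fun x : ℝ => Real.pi * x) atTop atTop :=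
    tendsto_id.const_mul_atTop Real.pi_pos
  have h0 := (((Real.continuous_arctan.tendsto 0).comp
    (Real.tendsto_exp_atBot.comp hbot)).const_mul (2 / Real.pi))
  have h1 := (((tendsto_nhds_of_tendsto_nhdsWithin Real.tendsto_arctan_atTop).comp
    (Real.tendsto_exp_atTop.comp htop)).const_mul (2 / Real.pi))
  rw [integral_of_hasDerivAt_of_tendsto hd integrable_inv_cosh_pi_mul h0 h1]
  have := Real.pi_ne_zero
  simp

lemma sinh_pi_mul_ne_zero {w : ℂ} (hw : |w.im| < 1) (h0 : w ≠ 0) :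
    Complex.sinh (Real.pi * w) ≠ 0 := by
  intro h
  have h' : Complex.sin (Real.pi * w * Complex.I) = 0 := by rw [Complex.sin_mul_I, h, zero_mul]
  obtain ⟨k, hk⟩ := Complex.sin_eq_zero_iff.1 h'
  have hk' : w * Complex.I = k := by
    have := Complex.ofReal_ne_zero.2 Real.pi_ne_zero
    apply mul_left_cancel₀ this
    linear_combination hk
  have hre : -w.im = (k : ℝ) := by simpa using congrArg Complex.re hk'
  have hk0 : k = 0 := by
    rw [← Int.abs_lt_one_iff]
    rw [← abs_neg, hre] at hw
    exact_mod_cast hw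
  simp [hk0, h0] at hk'

lemma abs_sinh_le_norm_sinh (x y : ℝ) : |Real.sinh x| ≤ ‖Complex.sinh (x + y * Complex.I)‖ := by
  refine abs_le_of_sq_le_sq ?_ (norm_nonneg _)
  rw [Complex.sq_norm, Complex.sinh_add, Complex.sinh_mul_I, Complex.cosh_mul_I,
    ← Complex.ofReal_sinh, ← Complex.ofReal_cosh, ← Complex.ofReal_sin, ← Complex.ofReal_cos,
    Complex.normSq_apply]
  simp only [Complex.add_re, Complex.add_im, Complex.mul_re, Complex.mul_im, Complex.ofReal_re,
    Complex.ofReal_im, Complex.I_re, Complex.I_im, mul_zero, zero_mul, mul_one, sub_zero,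
    add_zero, zero_add]
  have h : (Real.sinh x * Real.cos y) * (Real.sinh x * Real.cos y)
      + Real.cosh x * Real.sin y * (Real.cosh x * Real.sin y)
      = Real.sinh x ^ 2 + Real.sin y ^ 2 := by
    linear_combination Real.sin y ^ 2 * Real.cosh_sq x
      + Real.sinh x ^ 2 * Real.sin_sq_add_cos_sq y
  rw [h]
  linarith [sq_nonneg (Real.sin y)]

lemma norm_div_sinh_pi_mul_le {N : ℂ → ℂ} {C R : ℝ} {x y : ℝ} (hR : 1 ≤ R) (hx : |x| = R)
    (hy : |y| ≤ 1 / 2) (hN : ‖N (x + y * Complex.I)‖ ≤ C * ‖(x + y * Complex.I : ℂ)‖) :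
    ‖N (x + y * Complex.I) / Complex.sinh (Real.pi * (x + y * Complex.I))‖
      ≤ C * (8 * (1 + R ^ 2)⁻¹) := by
  have hw : ‖(x + y * Complex.I : ℂ)‖ ≤ 1 + R := by
    refine (norm_add_le _ _).trans ?_
    simp only [Complex.norm_real, norm_mul, Complex.norm_I, mul_one, Real.norm_eq_abs]
    linarith
  have hw0 : 0 < ‖(x + y * Complex.I : ℂ)‖ := by
    refine lt_of_lt_of_le (by linarith : 0 < |x|) ?_
    simpa using Complex.abs_re_le_norm (x + y * Complex.I)
  have hC0 : 0 ≤ C := nonneg_of_mul_nonneg_left ((norm_nonneg _).trans hN) hw0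
  have hs : Real.cosh (Real.pi * R) / 2 ≤ Real.sinh (Real.pi * R) := by
    rw [Real.cosh_eq, Real.sinh_eq]
    have h1 := Real.add_one_le_exp (Real.pi * R)
    have h2 : Real.exp (-(Real.pi * R)) ≤ 1 := Real.exp_le_one_iff.2 (by nlinarith [Real.pi_pos])
    nlinarith [Real.pi_gt_three]
  have hs' : Real.sinh (Real.pi * R) ≤ ‖Complex.sinh (Real.pi * (x + y * Complex.I))‖ := by
    have := abs_sinh_le_norm_sinh (Real.pi * x) (Real.pi * y)
    rw [Real.abs_sinh, abs_mul, hx, abs_of_pos Real.pi_pos] at this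
    convert this using 3
    push_cast
    ring
  have hc := Real.cosh_pos (Real.pi * R)
  have hb := one_add_abs_div_cosh_pi_mul_le R
  rw [abs_of_nonneg (by linarith)] at hb
  rw [norm_div]
  calc _ ≤ C * (1 + R) / (Real.cosh (Real.pi * R) / 2) := by
        gcongr
        · exact hN.trans (by gcongr)
        · exact hs.trans hs'
    _ = C * (2 * ((1 + R) / Real.cosh (Real.pi * R))) := by field_simp
    _ ≤ C * (2 * (4 * (1 + R ^ 2)⁻¹)) := by gcongr
    _ = _ := by ring

/-- Shifting the contour of `N w / sinh (π w)` between the lines `Im w = ± 1 / 2`. -/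
theorem integrable_and_integral_inv_cosh_smul_eq_zero {N : ℂ → ℂ} {δ C : ℝ}
    (hδ : 1 / 2 < δ) (hδ1 : δ ≤ 1)
    (hN : DifferentiableOn ℂ N {w | |w.im| < δ}) (hC : ∀ w : ℂ, |w.im| < δ → ‖N w‖ ≤ C * ‖w‖) :
    (Integrable fun x : ℝ => (Real.cosh (Real.pi * x))⁻¹ •
      (N (x + ((1 / 2 : ℝ) : ℂ) * Complex.I) + N (x + ((-(1 / 2) : ℝ) : ℂ) * Complex.I))) ∧
    ∫ x : ℝ, (Real.cosh (Real.pi * x))⁻¹ •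
      (N (x + ((1 / 2 : ℝ) : ℂ) * Complex.I) + N (x + ((-(1 / 2) : ℝ) : ℂ) * Complex.I)) = 0 := by
  set S : Set ℂ := {w | |w.im| < δ} with hS
  have hSo : IsOpen S := isOpen_lt (by fun_prop) continuous_const
  have h0S : (0 : ℂ) ∈ S := by simp only [hS, Set.mem_ofPred_eq, Complex.zero_im, abs_zero]; linarith
  have hS0 : S ∈ 𝓝 (0 : ℂ) := hSo.mem_nhds h0S
  have hN0 : N 0 = 0 := by simpa using hC 0 h0S
  have hline : ∀ y : ℝ, |y| ≤ 1 / 2 → ∀ x : ℝ, (x + y * Complex.I : ℂ) ∈ S := fun y hy x => by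
    simp only [hS, Set.mem_ofPred_eq, Complex.add_im, Complex.ofReal_im, Complex.mul_im,
      Complex.ofReal_re, Complex.I_im, Complex.I_re]
    simp only [mul_one, mul_zero, zero_add, add_zero]
    linarith
  have hcont : ∀ y : ℝ, |y| ≤ 1 / 2 → Continuous fun x : ℝ => N (x + y * Complex.I) :=
    fun y hy => hN.continuousOn.comp_continuous (by fun_prop) (hline y hy)
  have hint : ∀ y : ℝ, |y| ≤ 1 / 2 →
      Integrable fun x : ℝ => (Real.cosh (Real.pi * x))⁻¹ • N (x + y * Complex.I) := by
    intro y hy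
    have hC0 : 0 ≤ C := by
      have := (norm_nonneg _).trans (hC 1 (by simp only [Complex.one_im, abs_zero]; linarith))
      simpa using this
    refine integrable_inv_cosh_pi_mul_smul (hcont y hy) (C := C) fun x => (hC _ (hline y hy x)).trans ?_
    gcongr
    refine (norm_add_le _ _).trans ?_
    simp only [Complex.norm_real, norm_mul, Complex.norm_I, mul_one, Real.norm_eq_abs]
    linarith
  have hp : |(1 / 2 : ℝ)| ≤ 1 / 2 := by norm_num
  have hm : |(-(1 / 2) : ℝ)| ≤ 1 / 2 := by norm_num
  have hI := (hint _ hp).add (hint _ hm)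
  have hI' : Integrable fun x : ℝ => (Real.cosh (Real.pi * x))⁻¹ •
      (N (x + ((1 / 2 : ℝ) : ℂ) * Complex.I) + N (x + ((-(1 / 2) : ℝ) : ℂ) * Complex.I)) :=
    hI.congr (ae_of_all _ fun x => (smul_add _ _ _).symm)
  refine ⟨hI', ?_⟩
  -- the quotient `N w / sinh (π w)`, with its removable singularity at `0` filled in
  set s : ℂ → ℂ := fun w => Complex.sinh (Real.pi * w) with hs
  set f : ℂ → ℂ := fun w => dslope N 0 w / dslope s 0 w with hf
  have hsd : Differentiable ℂ s := by fun_prop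
  have hfne : ∀ w ≠ 0, f w = N w / s w := by
    intro w hw
    simp only [hf, dslope_of_ne _ hw, slope_def_field, hN0, hs, mul_zero, Complex.sinh_zero,
      sub_zero]
    field_simp
  have hfd : DifferentiableOn ℂ f S := by
    refine ((Complex.differentiableOn_dslope hS0).2 hN).div
      ((Complex.differentiableOn_dslope hS0).2 hsd.differentiableOn) fun w hw => ?_
    rcases eq_or_ne w 0 with rfl | hw0
    · rw [dslope_same]
      have : HasDerivAt s (Complex.cosh (Real.pi * 0) * (Real.pi * 1)) 0 :=
        ((hasDerivAt_id (0 : ℂ)).const_mul (Real.pi : ℂ)).csinh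
      rw [this.deriv]
      simp
    · rw [dslope_of_ne _ hw0, slope_def_field]
      simp only [hs, mul_zero, Complex.sinh_zero, sub_zero]
      exact div_ne_zero (sinh_pi_mul_ne_zero (lt_of_lt_of_le hw hδ1) hw0) hw0
  have hfcont : ∀ y : ℝ, |y| ≤ 1 / 2 → Continuous fun x : ℝ => f (x + y * Complex.I) :=
    fun y hy => hfd.continuousOn.comp_continuous (by fun_prop) (hline y hy)
  have hcosh : ∀ x : ℝ, (Real.cosh (Real.pi * x) : ℂ) ≠ 0 := fun x =>
    Complex.ofReal_ne_zero.2 (Real.cosh_pos _).ne'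
  have hne : ∀ x y : ℝ, y ≠ 0 → (x + y * Complex.I : ℂ) ≠ 0 := fun x y hy h => hy (by
    simpa using congrArg Complex.im h)
  have hsp : ∀ x : ℝ, s (x + ((1 / 2 : ℝ) : ℂ) * Complex.I)
      = Real.cosh (Real.pi * x) * Complex.I := by
    intro x
    have : (Real.pi * (x + ((1 / 2 : ℝ) : ℂ) * Complex.I) : ℂ)
      = (Real.pi * x : ℂ) + (Real.pi / 2 : ℂ) * Complex.I := by push_cast; ring
    simp only [hs, this, Complex.sinh_add, Complex.sinh_mul_I, Complex.cosh_mul_I,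
      Complex.sin_pi_div_two, Complex.cos_pi_div_two]
    simp
  have hsm : ∀ x : ℝ, s (x + ((-(1 / 2) : ℝ) : ℂ) * Complex.I)
      = -(Real.cosh (Real.pi * x) * Complex.I) := by
    intro x
    have : (Real.pi * (x + ((-(1 / 2) : ℝ) : ℂ) * Complex.I) : ℂ)
      = (Real.pi * x : ℂ) - (Real.pi / 2 : ℂ) * Complex.I := by push_cast; ring
    simp only [hs, this, Complex.sinh_sub, Complex.sinh_mul_I, Complex.cosh_mul_I,
      Complex.sin_pi_div_two, Complex.cos_pi_div_two]
    simp
  have hdiff : ∀ x : ℝ, f (x + ((-(1 / 2) : ℝ) : ℂ) * Complex.I)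
      - f (x + ((1 / 2 : ℝ) : ℂ) * Complex.I) = Complex.I * ((Real.cosh (Real.pi * x))⁻¹ •
      (N (x + ((1 / 2 : ℝ) : ℂ) * Complex.I) + N (x + ((-(1 / 2) : ℝ) : ℂ) * Complex.I))) := by
    intro x
    rw [hfne _ (hne _ _ (by norm_num)), hfne _ (hne _ _ (by norm_num)), hsp, hsm,
      Complex.real_smul]
    have := hcosh x
    have hI := Complex.I_ne_zero
    rw [div_neg, Complex.ofReal_inv]
    field_simp
    rw [Complex.I_sq]
    ring
  have hvert : ∀ R : ℝ, 1 ≤ R → ∀ x : ℝ, |x| = R →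
      ‖∫ y in (-(1 / 2) : ℝ)..(1 / 2), f (x + y * Complex.I)‖ ≤ C * (8 * (1 + R ^ 2)⁻¹) := by
    intro R hR x hx
    have := intervalIntegral.norm_integral_le_of_norm_le_const (a := (-(1 / 2) : ℝ))
      (b := (1 / 2)) (f := fun y : ℝ => f (x + y * Complex.I)) (C := C * (8 * (1 + R ^ 2)⁻¹))
      fun y hy => by
        have hy' : |y| ≤ 1 / 2 := by
          rw [Set.uIoc_of_le (by norm_num)] at hy
          exact abs_le.2 ⟨hy.1.le, hy.2⟩
        have h0 : (x + y * Complex.I : ℂ) ≠ 0 := fun h => by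
          have : x = 0 := by simpa using congrArg Complex.re h
          simp [this] at hx
          linarith
        rw [hfne _ h0]
        exact norm_div_sinh_pi_mul_le hR hx hy' (hC _ (hline y hy' x))
    norm_num at this ⊢
    exact this
  have hrect : ∀ R : ℝ, 1 ≤ R → ‖∫ x in (-R)..R, ((Real.cosh (Real.pi * x))⁻¹ •
      (N (x + ((1 / 2 : ℝ) : ℂ) * Complex.I) + N (x + ((-(1 / 2) : ℝ) : ℂ) * Complex.I)))‖
      ≤ C * (8 * (1 + R ^ 2)⁻¹) + C * (8 * (1 + R ^ 2)⁻¹) := by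
    intro R hR
    have h := Complex.integral_boundary_rect_eq_zero_of_differentiableOn f
      (⟨-R, -(1 / 2)⟩ : ℂ) (⟨R, 1 / 2⟩ : ℂ) (hfd.mono fun w hw => by
        have := hw.2
        rw [Set.mem_preimage, Set.uIcc_of_le (by norm_num)] at this
        exact (abs_le.2 this).trans_lt hδ)
    simp only at h
    rw [← intervalIntegral.integral_sub ((hfcont _ hm).intervalIntegrable _ _)
      ((hfcont _ hp).intervalIntegrable _ _)] at h
    simp only [hdiff, intervalIntegral.integral_const_mul, smul_eq_mul] at h
    have h' : (∫ x in (-R)..R, ((Real.cosh (Real.pi * x))⁻¹ •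
      (N (x + ((1 / 2 : ℝ) : ℂ) * Complex.I) + N (x + ((-(1 / 2) : ℝ) : ℂ) * Complex.I))))
      = (∫ y in (-(1 / 2) : ℝ)..(1 / 2), f ((-R : ℝ) + y * Complex.I))
        - ∫ y in (-(1 / 2) : ℝ)..(1 / 2), f (R + y * Complex.I) := by
      apply mul_left_cancel₀ Complex.I_ne_zero
      linear_combination h
    rw [h']
    exact (norm_sub_le _ _).trans (add_le_add
      (hvert R hR _ (by rw [abs_neg, abs_of_nonneg (by linarith)]))
      (hvert R hR _ (abs_of_nonneg (by linarith))))
  have hlim := intervalIntegral_tendsto_integral hI' tendsto_neg_atTop_atBot tendsto_id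
  refine tendsto_nhds_unique hlim (squeeze_zero_norm' ((eventually_ge_atTop 1).mono hrect) ?_)
  have h1 : Tendsto (fun R : ℝ => (1 + R ^ 2)⁻¹) atTop (𝓝 0) :=
    tendsto_inv_atTop_zero.comp
      (tendsto_atTop_add_const_left _ _ (tendsto_pow_atTop two_ne_zero))
  simpa using ((h1.const_mul 8).const_mul C).add ((h1.const_mul 8).const_mul C)

lemma norm_clog_add_sub_clog_le {b c : ℝ} (hc : 0 < c) (hcb : c ≤ b) {z : ℂ}
    (hz : c ≤ b + z.re) : ‖Complex.log (b + z) - Complex.log b‖ ≤ c⁻¹ * ‖z‖ := by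
  have hconv : Convex ℝ {w : ℂ | c ≤ w.re} := convex_halfSpace_re_ge c
  have h := hconv.norm_image_sub_le_of_norm_hasDerivWithin_le (f := Complex.log)
    (f' := fun w => w⁻¹) (C := c⁻¹) (x := (b : ℂ)) (y := b + z)
    (fun w hw => (Complex.hasDerivAt_log (Or.inl (hc.trans_le hw))).hasDerivWithinAt)
    (fun w hw => by
      rw [norm_inv]
      exact inv_anti₀ hc (le_trans hw (Complex.re_le_norm w)))
    (show c ≤ (b : ℂ).re by simpa using hcb) (show c ≤ (b + z : ℂ).re by simpa using hz)
  simpa using h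

lemma abs_log_sq_add_sub_le {b : ℝ} (hb : 0 < b) (x : ℝ) :
    |Real.log (b ^ 2 + 4 * x ^ 2) - 2 * Real.log b| ≤ 4 / b * |x| := by
  have hx := abs_nonneg x
  have h1 : 2 * Real.log b ≤ Real.log (b ^ 2 + 4 * x ^ 2) := by
    have : 2 * Real.log b = Real.log (b ^ 2) := by simp
    rw [this]
    exact Real.log_le_log (by positivity) (by nlinarith [sq_nonneg x])
  have h2 : Real.log (b ^ 2 + 4 * x ^ 2) ≤ 2 * (Real.log b + Real.log (1 + 2 * |x| / b)) := by
    rw [← Real.log_mul hb.ne' (by positivity)]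
    have : ∀ t : ℝ, 2 * Real.log t = Real.log (t ^ 2) := by simp
    rw [this]
    apply Real.log_le_log (by positivity)
    have h3 : b * (1 + 2 * |x| / b) = b + 2 * |x| := by field_simp
    rw [h3]
    nlinarith [sq_abs x]
  have h3 : Real.log (1 + 2 * |x| / b) ≤ 2 * |x| / b := by
    have := Real.log_le_sub_one_of_pos (x := 1 + 2 * |x| / b) (by positivity)
    linarith
  rw [abs_of_nonneg (by linarith)]
  calc _ ≤ 2 * (2 * |x| / b) := by linarith
    _ = _ := by ring

lemma continuous_log_sq_add {b : ℝ} (hb : 0 < b) :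
    Continuous fun x : ℝ => Real.log (b ^ 2 + 4 * x ^ 2) :=
  Continuous.log (by fun_prop) fun x => by positivity

lemma integrable_log_sq_add_sub {b : ℝ} (hb : 0 < b) : Integrable fun x : ℝ =>
    (Real.cosh (Real.pi * x))⁻¹ • (Real.log (b ^ 2 + 4 * x ^ 2) - 2 * Real.log b) := by
  refine integrable_inv_cosh_pi_mul_smul ((continuous_log_sq_add hb).sub continuous_const)
    (C := 4 / b) fun x => ?_
  refine (abs_log_sq_add_sub_le hb x).trans ?_
  gcongr
  linarith

lemma integrable_log_sq_add {b : ℝ} (hb : 0 < b) : Integrable fun x : ℝ =>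
    (Real.cosh (Real.pi * x))⁻¹ * Real.log (b ^ 2 + 4 * x ^ 2) := by
  have h := (integrable_log_sq_add_sub hb).add
    (integrable_inv_cosh_pi_mul.mul_const (2 * Real.log b))
  refine h.congr (ae_of_all _ fun x => ?_)
  simp only [Pi.add_apply, smul_eq_mul]
  ring

lemma integral_log_add_integral_log {a : ℝ} (ha : 0 < a) :
    (∫ x : ℝ, (Real.cosh (Real.pi * x))⁻¹ * Real.log (a ^ 2 + 4 * x ^ 2)) +
      ∫ x : ℝ, (Real.cosh (Real.pi * x))⁻¹ * Real.log ((a + 2) ^ 2 + 4 * x ^ 2)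
      = 4 * Real.log (a + 1) := by
  set δ : ℝ := min 1 (1 / 2 + a / 4) with hδ
  have hδ2 : 1 / 2 < δ := lt_min (by norm_num) (by linarith)
  have hre : ∀ w : ℂ, |w.im| < δ → a / 2 ≤ (a + 1 : ℝ) + (2 * Complex.I * w).re := by
    intro w hw
    have h1 := (le_abs_self w.im).trans (hw.le.trans (min_le_right _ _))
    simp
    linarith
  set N : ℂ → ℂ := fun w =>
    Complex.log ((a + 1 : ℝ) + 2 * Complex.I * w) - Complex.log (a + 1 : ℝ) with hN
  have hC : ∀ w : ℂ, |w.im| < δ → ‖N w‖ ≤ (4 / a) * ‖w‖ := by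
    intro w hw
    refine (norm_clog_add_sub_clog_le (half_pos ha) (by linarith) (hre w hw)).trans
      (le_of_eq ?_)
    simp only [norm_mul, Complex.norm_I, Complex.norm_ofNat]
    ring
  have hd : DifferentiableOn ℂ N {w | |w.im| < δ} := by
    refine DifferentiableOn.sub_const (DifferentiableOn.clog (by fun_prop) fun w hw => ?_) _
    left
    have := hre w hw
    rw [Complex.add_re, Complex.ofReal_re]
    linarith
  obtain ⟨hi, h0⟩ := integrable_and_integral_inv_cosh_smul_eq_zero hδ2 (min_le_left _ _) hd hC
  have hlog : ∀ b x : ℝ, (Complex.log (b + 2 * x * Complex.I)).re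
      = Real.log (b ^ 2 + 4 * x ^ 2) / 2 := by
    intro b x
    rw [Complex.log_re, ← Real.log_sqrt (by positivity)]
    congr 1
    rw [← Real.sqrt_sq (norm_nonneg _), Complex.sq_norm, Complex.normSq_apply]
    congr 1
    simp
    ring
  have key : ∀ x : ℝ, RCLike.re ((Real.cosh (Real.pi * x))⁻¹ •
      (N (x + ((1 / 2 : ℝ) : ℂ) * Complex.I) + N (x + ((-(1 / 2) : ℝ) : ℂ) * Complex.I)))
      = ((Real.cosh (Real.pi * x))⁻¹ * Real.log (a ^ 2 + 4 * x ^ 2)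
        + (Real.cosh (Real.pi * x))⁻¹ * Real.log ((a + 2) ^ 2 + 4 * x ^ 2)) / 2
        - (Real.cosh (Real.pi * x))⁻¹ * (2 * Real.log (a + 1)) := by
    intro x
    have e1 : ((a + 1 : ℝ) + 2 * Complex.I * (x + ((1 / 2 : ℝ) : ℂ) * Complex.I) : ℂ)
        = (a : ℝ) + 2 * x * Complex.I := by
      push_cast
      linear_combination Complex.I_sq
    have e2 : ((a + 1 : ℝ) + 2 * Complex.I * (x + ((-(1 / 2) : ℝ) : ℂ) * Complex.I) : ℂ)
        = (a + 2 : ℝ) + 2 * x * Complex.I := by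
      push_cast
      linear_combination -Complex.I_sq
    rw [RCLike.smul_re, RCLike.re_eq_complex_re]
    simp only [hN, Complex.add_re, Complex.sub_re]
    rw [e1, e2, hlog, hlog, ← Complex.ofReal_log (by linarith), Complex.ofReal_re]
    ring
  have h := integral_re hi
  rw [h0] at h
  simp only [key] at h
  have i1 := integrable_log_sq_add ha
  have i2 := integrable_log_sq_add (b := a + 2) (by linarith)
  have i12 : Integrable fun x : ℝ => ((Real.cosh (Real.pi * x))⁻¹ * Real.log (a ^ 2 + 4 * x ^ 2)
      + (Real.cosh (Real.pi * x))⁻¹ * Real.log ((a + 2) ^ 2 + 4 * x ^ 2)) / 2 :=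
    (i1.add i2).div_const 2
  rw [integral_sub i12 (integrable_inv_cosh_pi_mul.mul_const _),
    integral_div, integral_add i1 i2, integral_mul_const, integral_inv_cosh_pi_mul] at h
  simp only [map_zero] at h
  linarith

lemma exists_abs_integral_log_sub_le : ∃ K : ℝ, ∀ b : ℝ, 0 < b →
    |(∫ x : ℝ, (Real.cosh (Real.pi * x))⁻¹ * Real.log (b ^ 2 + 4 * x ^ 2)) - 2 * Real.log b|
      ≤ K / b := by
  refine ⟨∫ x : ℝ, 4 * ((Real.cosh (Real.pi * x))⁻¹ • |x|), fun b hb => ?_⟩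
  have hx : Integrable fun x : ℝ => (Real.cosh (Real.pi * x))⁻¹ • |x| :=
    integrable_inv_cosh_pi_mul_smul continuous_abs (C := 1) fun x => by simp
  have h : (∫ x : ℝ, (Real.cosh (Real.pi * x))⁻¹ * Real.log (b ^ 2 + 4 * x ^ 2))
      - 2 * Real.log b = ∫ x : ℝ, (Real.cosh (Real.pi * x))⁻¹ •
        (Real.log (b ^ 2 + 4 * x ^ 2) - 2 * Real.log b) := by
    simp only [smul_eq_mul, mul_sub]
    rw [integral_sub (integrable_log_sq_add hb) (integrable_inv_cosh_pi_mul.mul_const _),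
      integral_mul_const, integral_inv_cosh_pi_mul, one_mul]
  rw [h, ← integral_div, ← Real.norm_eq_abs]
  refine norm_integral_le_of_norm_le ((hx.const_mul 4).div_const b) (ae_of_all _ fun x => ?_)
  rw [norm_smul, Real.norm_eq_abs, Real.norm_eq_abs, abs_inv,
    abs_of_pos (Real.cosh_pos _)]
  have hc := Real.cosh_pos (Real.pi * x)
  refine (mul_le_mul_of_nonneg_left (abs_log_sq_add_sub_le hb x) (inv_nonneg.2 hc.le)).trans
    (le_of_eq ?_)
  rw [smul_eq_mul]
  ring

lemma log_Gamma_add_half_sub_le {q : ℝ} (hq : 0 < q) :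
    Real.log (Real.Gamma (q + 1 / 2)) - Real.log (Real.Gamma q) ≤ Real.log q / 2 := by
  have h := Real.convexOn_log_Gamma.2 (Set.mem_Ioi.2 hq) (Set.mem_Ioi.2 (by linarith : 0 < q + 1))
    (by norm_num : (0 : ℝ) ≤ 1 / 2) (by norm_num : (0 : ℝ) ≤ 1 / 2) (by norm_num)
  have e : (1 / 2 : ℝ) • q + (1 / 2 : ℝ) • (q + 1) = q + 1 / 2 := by
    simp only [smul_eq_mul]; ring
  rw [e] at h
  simp only [Function.comp, smul_eq_mul] at h
  rw [Real.Gamma_add_one hq.ne', Real.log_mul hq.ne' (Real.Gamma_pos_of_pos hq).ne'] at h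
  linarith

lemma tendsto_log_Gamma_ratio : Tendsto (fun b : ℝ => 2 * Real.log 2
    - 2 * Real.log (Real.Gamma (b / 4 + 1 / 4)) + 2 * Real.log (Real.Gamma (b / 4 + 3 / 4))
    - Real.log b) atTop (𝓝 0) := by
  have hlog : ∀ c : ℝ, Tendsto (fun b : ℝ => Real.log (1 + c / b)) atTop (𝓝 0) := by
    intro c
    have h1 : Tendsto (fun b : ℝ => 1 + c / b) atTop (𝓝 (1 + 0)) :=
      (tendsto_const_nhds (x := (1 : ℝ))).add (tendsto_const_nhds.div_atTop tendsto_id)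
    rw [add_zero] at h1
    simpa using h1.log one_ne_zero
  have h4 : Real.log 4 = 2 * Real.log 2 := by
    rw [show (4 : ℝ) = 2 ^ 2 by norm_num, Real.log_pow]; norm_num
  have hform : ∀ b c : ℝ, 0 < b → 0 < b + c →
      Real.log (1 + c / b) = 2 * Real.log 2 + Real.log ((b + c) / 4) - Real.log b := by
    intro b c hb hc
    rw [Real.log_div hc.ne' (by norm_num), h4, show 1 + c / b = (b + c) / b by field_simp,
      Real.log_div hc.ne' hb.ne']
    ring
  refine tendsto_of_tendsto_of_tendsto_of_le_of_le' (hlog (-1)) (hlog 1) ?_ ?_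
  · filter_upwards [eventually_gt_atTop 1] with b hb
    rw [hform b (-1) (by linarith) (by linarith)]
    have hq : 0 < (b + -1) / 4 := by linarith
    have h := log_Gamma_add_half_sub_le hq
    have hG := Real.Gamma_add_one hq.ne'
    have h' := log_Gamma_add_half_sub_le (q := b / 4 + 1 / 4) (by linarith)
    rw [show b / 4 + 3 / 4 = (b + -1) / 4 + 1 by ring, hG,
      Real.log_mul hq.ne' (Real.Gamma_pos_of_pos hq).ne']
    rw [show (b + -1) / 4 + 1 / 2 = b / 4 + 1 / 4 by ring] at h
    linarith
  · filter_upwards [eventually_gt_atTop 0] with b hb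
    rw [hform b 1 hb (by linarith)]
    have h := log_Gamma_add_half_sub_le (q := b / 4 + 1 / 4) (by linarith)
    rw [show b / 4 + 1 / 4 + 1 / 2 = b / 4 + 3 / 4 by ring] at h
    rw [show (b + 1) / 4 = b / 4 + 1 / 4 by ring]
    linarith

lemma eq_zero_of_forall_add_two_eq_neg {D : ℝ → ℝ} (hD : ∀ b, 0 < b → D (b + 2) = -D b)
    (hlim : Tendsto D atTop (𝓝 0)) {a : ℝ} (ha : 0 < a) : D a = 0 := by
  have habs : ∀ n : ℕ, |D (a + 2 * n)| = |D a| := by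
    intro n
    induction n with
    | zero => simp
    | succ n ih =>
      rw [← ih, show a + 2 * ((n + 1 : ℕ) : ℝ) = (a + 2 * n) + 2 by push_cast; ring,
        hD _ (by positivity), abs_neg]
  have ht : Tendsto (fun n : ℕ => a + 2 * (n : ℝ)) atTop atTop :=
    tendsto_atTop_add_const_left _ _
      (tendsto_natCast_atTop_atTop.const_mul_atTop (by norm_num))
  have h := (hlim.comp ht).abs
  simp only [Function.comp, habs, abs_zero] at h
  exact abs_eq_zero.1 (tendsto_nhds_unique tendsto_const_nhds h)

/-- `∫_0^∞ log(a² + 4v²)/cosh(πv) dv = 2 log 2 - 2 log Γ(a/4+1/4) + 2 log Γ(a/4+3/4)`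
for real `a > 0`. -/
theorem integral_log_div_cosh (a : ℝ) (ha : 0 < a) :
    ∫ v in Set.Ioi (0 : ℝ), Real.log (a ^ 2 + 4 * v ^ 2) / Real.cosh (Real.pi * v) =
      2 * Real.log 2 - 2 * Real.log (Real.Gamma (a / 4 + 1 / 4)) +
        2 * Real.log (Real.Gamma (a / 4 + 3 / 4)) := by
  set J : ℝ → ℝ := fun b =>
    ∫ x : ℝ, (Real.cosh (Real.pi * x))⁻¹ * Real.log (b ^ 2 + 4 * x ^ 2) with hJ
  set G : ℝ → ℝ := fun b => 2 * Real.log 2 - 2 * Real.log (Real.Gamma (b / 4 + 1 / 4)) +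
    2 * Real.log (Real.Gamma (b / 4 + 3 / 4)) with hG
  have heven : J a = 2 * ∫ v in Set.Ioi (0 : ℝ),
      Real.log (a ^ 2 + 4 * v ^ 2) / Real.cosh (Real.pi * v) := by
    rw [← integral_comp_abs]
    refine integral_congr_ae (ae_of_all _ fun x => ?_)
    have : Real.cosh (Real.pi * |x|) = Real.cosh (Real.pi * x) := by
      rw [← Real.cosh_abs (Real.pi * x), abs_mul, abs_of_pos Real.pi_pos]
    simp only [sq_abs, this]
    ring
  have hGadd : ∀ b, 0 < b → G b + G (b + 2) = 2 * Real.log (b + 1) := by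
    intro b hb
    have hq : 0 < b / 4 + 1 / 4 := by linarith
    simp only [hG]
    rw [show (b + 2) / 4 + 1 / 4 = b / 4 + 3 / 4 by ring,
      show (b + 2) / 4 + 3 / 4 = b / 4 + 1 / 4 + 1 by ring, Real.Gamma_add_one hq.ne',
      Real.log_mul hq.ne' (Real.Gamma_pos_of_pos hq).ne',
      show b + 1 = 2 ^ 2 * (b / 4 + 1 / 4) by ring, Real.log_mul (by norm_num) hq.ne',
      Real.log_pow]
    push_cast
    ring
  have hD : ∀ b, 0 < b → J (b + 2) / 2 - G (b + 2) = -(J b / 2 - G b) := by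
    intro b hb
    have h1 := integral_log_add_integral_log hb
    have h2 := hGadd b hb
    simp only [hJ]
    linarith
  have hlim : Tendsto (fun b => J b / 2 - G b) atTop (𝓝 0) := by
    obtain ⟨K, hK⟩ := exists_abs_integral_log_sub_le
    have h1 : Tendsto (fun b => J b - 2 * Real.log b) atTop (𝓝 0) :=
      squeeze_zero_norm' ((eventually_gt_atTop 0).mono hK)
        (tendsto_const_nhds.div_atTop tendsto_id)
    have h2 := (h1.div_const 2).sub tendsto_log_Gamma_ratio
    rw [zero_div, sub_zero] at h2
    refine h2.congr fun b => ?_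
    simp only [hG]
    ring
  have h := eq_zero_of_forall_add_two_eq_neg hD hlim ha
  change _ = G a
  linarith
end

section
/- The integral ∫_0^∞ v·arctan(2v) / cosh(πv) dv equals -log(π)/4 - 1/4 + 3 log A - log(2)/12, where A is the Glaisher–Kinkelin constant. -/
open MeasureTheory

open Set Filter Topology Complex in
lemma hasSum_neg_one_pow_div_nat_cpow {s : ℂ} (hs : 1 < s.re) :
    HasSum (fun n : ℕ ↦ (-1 : ℂ) ^ n / ((n : ℂ) + 1) ^ s)
      ((1 - 2 ^ (1 - s)) * riemannZeta s) := by
  have hz : HasSum (fun n : ℕ ↦ 1 / ((n : ℂ) + 1) ^ s) (riemannZeta s) := by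
    rw [zeta_eq_tsum_one_div_nat_add_one_cpow hs]
    refine Summable.hasSum ?_
    simpa using (summable_nat_add_iff 1).mpr (Complex.summable_one_div_nat_cpow.mpr hs)
  have ho : HasSum (fun k : ℕ ↦ 1 / (((2 * k + 1 : ℕ) : ℂ) + 1) ^ s)
      (2 ^ (-s) * riemannZeta s) := by
    convert! hz.mul_left ((2 : ℂ) ^ (-s)) using 2 with k
    have : (((2 * k + 1 : ℕ) : ℂ) + 1) = ((2 : ℝ) : ℂ) * ((k + 1 : ℝ) : ℂ) := by push_cast; ring
    rw [this, mul_cpow_ofReal_nonneg (by norm_num) (by positivity), cpow_neg]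
    push_cast
    simp [mul_comm]
  have he : HasSum (fun k : ℕ ↦ 1 / (((2 * k : ℕ) : ℂ) + 1) ^ s)
      ((1 - 2 ^ (-s)) * riemannZeta s) := by
    obtain ⟨m, h⟩ : Summable (fun k : ℕ ↦ 1 / (((2 * k : ℕ) : ℂ) + 1) ^ s) :=
      hz.summable.comp_injective (i := fun k : ℕ ↦ 2 * k) (mul_right_injective₀ two_ne_zero)
    have := (HasSum.even_add_odd (f := fun n : ℕ ↦ 1 / ((n : ℂ) + 1) ^ s) h ho).unique hz
    rwa [show (1 - 2 ^ (-s)) * riemannZeta s = m by linear_combination -this]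
  have h2 : (2 : ℂ) ^ (1 - s) = 2 * 2 ^ (-s) := by
    rw [sub_eq_add_neg, cpow_add _ _ two_ne_zero, cpow_one]
  convert! HasSum.even_add_odd (f := fun n : ℕ ↦ (-1 : ℂ) ^ n / ((n : ℂ) + 1) ^ s)
    (m := (1 - 2 ^ (-s)) * riemannZeta s) (m' := -(2 ^ (-s) * riemannZeta s)) ?_ ?_ using 1
  · rw [h2]; ring
  · simpa [pow_mul] using he
  · simpa [pow_succ, pow_mul, neg_div] using ho.neg

open Set Filter Topology Complex in
lemma hasSum_exp_neg_mul_one_sub_div_sq {t : ℝ} (ht : 0 < t) :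
    HasSum (fun n : ℕ ↦ ((-1) ^ n * (2 * n + 1) : ℂ) * Real.exp (-(n + 1 : ℝ) * t))
      ((Real.exp (-t) * (1 - Real.exp (-t)) / (1 + Real.exp (-t)) ^ 2 : ℝ) : ℂ) := by
  set q := Real.exp (-t) with hq
  have hq0 : 0 < q := Real.exp_pos _
  have hq1 : ‖-q‖ < 1 := by
    rw [norm_neg, Real.norm_of_nonneg hq0.le, hq, Real.exp_lt_one_iff]; linarith
  have h := (((hasSum_coe_mul_geometric_of_norm_lt_one hq1).mul_left 2).add
    (hasSum_geometric_of_norm_lt_one hq1)).mul_left q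
  rw [← hasSum_ofReal] at h
  convert! h using 1
  · ext n
    have : Real.exp (-(n + 1 : ℝ) * t) = q * q ^ n := by
      rw [hq, ← Real.exp_nat_mul, ← Real.exp_add]; ring_nf
    rw [this, neg_pow q]
    push_cast
    ring
  · congr 1
    have : 1 + q ≠ 0 := by positivity
    simp only [sub_neg_eq_add]
    field_simp
    ring

open Set Filter Topology Complex in
lemma mellin_exp_neg_mul_one_sub_div_sq {s : ℂ} (hs : 2 < s.re) :
    mellin (fun t : ℝ ↦
      ((Real.exp (-t) * (1 - Real.exp (-t)) / (1 + Real.exp (-t)) ^ 2 : ℝ) : ℂ)) s =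
    Gamma s * (2 * ((1 - 2 ^ (2 - s)) * riemannZeta (s - 1)) -
      (1 - 2 ^ (1 - s)) * riemannZeta s) := by
  have h1 := hasSum_neg_one_pow_div_nat_cpow (s := s) (by linarith)
  have h2 := hasSum_neg_one_pow_div_nat_cpow (s := s - 1) (by simp; linarith)
  have h3 := ((h2.mul_left 2).sub h1).mul_left (Gamma s)
  have key (n : ℕ) : 2 * ((-1 : ℂ) ^ n / ((n : ℂ) + 1) ^ (s - 1)) - (-1 : ℂ) ^ n / ((n : ℂ) + 1) ^ s
      = ((-1) ^ n * (2 * n + 1) : ℂ) / ((n + 1 : ℝ) : ℂ) ^ s := by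
    have hn : (n : ℂ) + 1 ≠ 0 := by exact_mod_cast n.succ_ne_zero
    have := cpow_ne_zero_iff_of_exponent_ne_zero (x := (n : ℂ) + 1) (y := s)
      (by rintro rfl; simp at hs; linarith) |>.mpr hn
    rw [cpow_sub _ _ hn, cpow_one]
    push_cast
    field_simp
    ring
  simp only [key] at h3
  have h4 := hasSum_mellin (a := fun n : ℕ ↦ ((-1) ^ n * (2 * n + 1) : ℂ))
    (p := fun n : ℕ ↦ (n + 1 : ℝ)) (s := s) (fun n ↦ Or.inr (by positivity)) (by linarith)
    (fun t ht ↦ hasSum_exp_neg_mul_one_sub_div_sq ht) ?_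
  · simp only [← mul_div_assoc] at h3
    rw [h4.unique h3]
    ring_nf
  · have hs1 : Summable fun n : ℕ ↦ 2 * (1 / ((n + 1 : ℕ) : ℝ) ^ (s.re - 1)) :=
      ((summable_nat_add_iff 1).mpr
        (Real.summable_one_div_nat_rpow.mpr (by linarith : 1 < s.re - 1))).mul_left 2
    refine Summable.of_nonneg_of_le (fun n ↦ by positivity) (fun n ↦ ?_) hs1
    have hn : (0 : ℝ) < n + 1 := by positivity
    have : ‖((-1) ^ n * (2 * n + 1) : ℂ)‖ = 2 * n + 1 := by
      rw [norm_mul, norm_pow, norm_neg, norm_one, one_pow, one_mul]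
      exact_mod_cast Complex.norm_natCast (2 * n + 1)
    rw [this]
    push_cast
    rw [Real.rpow_sub_one hn.ne']
    have := Real.rpow_pos_of_pos hn s.re
    field_simp
    linarith

open Set Filter Topology Complex Asymptotics in
lemma differentiableAt_mellin_exp_neg_mul_one_sub_div_sq {s : ℂ} (hs : -1 < s.re) :
    DifferentiableAt ℂ (mellin (fun t : ℝ ↦
      ((Real.exp (-t) * (1 - Real.exp (-t)) / (1 + Real.exp (-t)) ^ 2 : ℝ) : ℂ))) s := by
  refine mellin_differentiableAt_of_isBigO_rpow_exp (a := 1) (b := -1) one_pos ?_ ?_ ?_ hs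
  · refine ContinuousOn.locallyIntegrableOn (Continuous.continuousOn ?_) measurableSet_Ioi
    refine continuous_ofReal.comp (Continuous.div (by fun_prop) (by fun_prop) fun t ↦ ?_)
    have := Real.exp_pos (-t)
    positivity
  · refine IsBigO.of_bound 1 ?_
    filter_upwards [eventually_gt_atTop 0] with t ht
    have h0 := Real.exp_pos (-t)
    have h1 : Real.exp (-t) < 1 := by rw [Real.exp_lt_one_iff]; linarith
    rw [norm_real, Real.norm_of_nonneg (by have := sub_pos.mpr h1; positivity),
      Real.norm_of_nonneg (by positivity), div_le_iff₀ (by positivity), neg_one_mul]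
    nlinarith [mul_pos h0 h0, mul_pos (mul_pos h0 h0) h0]
  · refine IsBigO.of_bound 1 ?_
    filter_upwards [self_mem_nhdsWithin] with t (ht : 0 < t)
    have h0 := Real.exp_pos (-t)
    have h1 : Real.exp (-t) < 1 := by rw [Real.exp_lt_one_iff]; linarith
    have h2 := Real.add_one_le_exp (-t)
    rw [norm_real, Real.norm_of_nonneg (by have := sub_pos.mpr h1; positivity), neg_neg,
      Real.rpow_one, Real.norm_of_nonneg ht.le, div_le_iff₀ (by positivity)]
    nlinarith [mul_pos ht h0, mul_pos ht (mul_pos h0 h0)]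

open Set Filter Topology Complex in
lemma mul_mellin_exp_neg_mul_one_sub_div_sq {s : ℂ} (hs : -1 < s.re) (h1 : s ≠ 1) (h2 : s ≠ 2) :
    s * mellin (fun t : ℝ ↦
      ((Real.exp (-t) * (1 - Real.exp (-t)) / (1 + Real.exp (-t)) ^ 2 : ℝ) : ℂ)) s =
    Gamma (s + 1) * (2 * ((1 - 2 ^ (2 - s)) * riemannZeta (s - 1)) -
      (1 - 2 ^ (1 - s)) * riemannZeta s) := by
  set M := mellin (fun t : ℝ ↦
      ((Real.exp (-t) * (1 - Real.exp (-t)) / (1 + Real.exp (-t)) ^ 2 : ℝ) : ℂ)) with hM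
  let U : Set ℂ := {z | -1 < z.re}
  have hU : IsOpen U := isOpen_lt continuous_const continuous_re
  have hUc : IsPreconnected U := (convex_halfSpace_re_gt (-1)).isPreconnected
  let f : ℂ → ℂ := fun z ↦ (z - 1) * (z - 2) * (z * M z)
  let g : ℂ → ℂ := fun z ↦ Gamma (z + 1) *
    (2 * ((1 - 2 ^ (2 - z)) * ((z - 1) * riemannZeta₁ (z - 1))) -
      (1 - 2 ^ (1 - z)) * ((z - 2) * riemannZeta₁ z))
  have hz {z : ℂ} (h1 : z ≠ 1) (h2 : z ≠ 2) : g z = (z - 1) * (z - 2) *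
      (Gamma (z + 1) * (2 * ((1 - 2 ^ (2 - z)) * riemannZeta (z - 1)) -
        (1 - 2 ^ (1 - z)) * riemannZeta z)) := by
    have h1' := sub_ne_zero.mpr h1
    have h2' := sub_ne_zero.mpr h2
    simp only [g]
    rw [riemannZeta_eq_inv_sub_mul h1, riemannZeta_eq_inv_sub_mul (s := z - 1) (by grind),
      show z - 1 - 1 = z - 2 by ring]
    field_simp
  have hf : AnalyticOnNhd ℂ f U := by
    refine DifferentiableOn.analyticOnNhd (fun z hz ↦ ?_) hU
    have : DifferentiableAt ℂ M z := differentiableAt_mellin_exp_neg_mul_one_sub_div_sq hz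
    exact DifferentiableAt.differentiableWithinAt (by fun_prop)
  have hg : AnalyticOnNhd ℂ g U := by
    refine DifferentiableOn.analyticOnNhd (fun z hz ↦ ?_) hU
    have hG : DifferentiableAt ℂ (fun z ↦ Gamma (z + 1)) z := by
      refine DifferentiableAt.comp z (differentiableAt_Gamma _ fun m hm ↦ ?_) (by fun_prop)
      have := congr_arg re hm
      simp only [add_re, one_re, neg_re, natCast_re] at this
      have hz' : -1 < z.re := hz
      have : (0 : ℝ) ≤ m := m.cast_nonneg
      linarith
    have hp (c : ℂ) : DifferentiableAt ℂ (fun z : ℂ ↦ (2 : ℂ) ^ (c - z)) z :=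
      DifferentiableAt.const_cpow (by fun_prop) (Or.inl two_ne_zero)
    have := hp 1
    have := hp 2
    exact DifferentiableAt.differentiableWithinAt (by fun_prop)
  have hfg : f =ᶠ[𝓝 3] g := by
    have : {z : ℂ | 2 < z.re} ∈ 𝓝 (3 : ℂ) :=
      (isOpen_lt continuous_const continuous_re).mem_nhds (by simp; norm_num)
    filter_upwards [this] with z (h : 2 < z.re)
    have h0 : z ≠ 0 := by rintro rfl; norm_num at h
    rw [hz (by rintro rfl; norm_num at h) (by rintro rfl; simp at h),
      Gamma_add_one _ h0]
    simp only [f, hM, mellin_exp_neg_mul_one_sub_div_sq h]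
    ring
  have := hf.eqOn_of_preconnected_of_eventuallyEq hg hUc (z₀ := 3) (by simp [U]; norm_num) hfg hs
  rw [hz h1 h2] at this
  exact mul_left_cancel₀ (mul_ne_zero (sub_ne_zero.mpr h1) (sub_ne_zero.mpr h2)) this

open Set Filter Topology Complex in
lemma mellin_exp_neg_mul_one_sub_div_sq_zero :
    mellin (fun t : ℝ ↦
      ((Real.exp (-t) * (1 - Real.exp (-t)) / (1 + Real.exp (-t)) ^ 2 : ℝ) : ℂ)) 0 =
    -6 * deriv riemannZeta (-1) - Real.log 2 / 6 - Real.log Real.pi / 2 := by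
  set M := mellin (fun t : ℝ ↦
      ((Real.exp (-t) * (1 - Real.exp (-t)) / (1 + Real.exp (-t)) ^ 2 : ℝ) : ℂ)) with hM
  have hL : HasDerivAt (fun s ↦ s * M s) (M 0) 0 := by
    have := (hasDerivAt_id (0 : ℂ)).mul
      (differentiableAt_mellin_exp_neg_mul_one_sub_div_sq (s := 0) (by simp)).hasDerivAt
    rw [← hM] at this
    convert! this using 1
    simp
  have hz0 : HasDerivAt riemannZeta (deriv riemannZeta 0) 0 :=
    (differentiableAt_riemannZeta zero_ne_one).hasDerivAt
  have hz1 : HasDerivAt (fun s ↦ riemannZeta (s - 1)) (deriv riemannZeta (-1)) 0 := by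
    have h : HasDerivAt riemannZeta (deriv riemannZeta (-1)) (0 - 1) := by
      rw [zero_sub]
      exact (differentiableAt_riemannZeta (by norm_num)).hasDerivAt
    exact h.comp_sub_const 0 1
  have hp (c : ℂ) : HasDerivAt (fun s : ℂ ↦ 1 - (2 : ℂ) ^ (c - s)) (2 ^ c * Complex.log 2) 0 := by
    have := (((hasDerivAt_id (0 : ℂ)).const_sub c).const_cpow
      (c := 2) (Or.inl two_ne_zero)).const_sub 1
    simpa using this
  have hG : HasDerivAt (fun s ↦ Gamma (s + 1)) (-Real.eulerMascheroniConstant) 0 := by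
    have h : HasDerivAt Gamma (-Real.eulerMascheroniConstant) (0 + 1) := by
      rw [zero_add]; exact hasDerivAt_Gamma_one
    exact h.comp_add_const 0 1
  have hR := hG.mul ((((hp 2).mul hz1).const_mul 2).sub ((hp 1).mul hz0))
  have hzm1 : riemannZeta (-1) = -1 / 12 := by
    have := riemannZeta_neg_nat_eq_bernoulli 1
    norm_num [bernoulli_two] at this
    rw [this]; norm_num
  have heq : (fun s ↦ s * M s) =ᶠ[𝓝 0] fun s ↦ Gamma (s + 1) *
      (2 * ((1 - 2 ^ (2 - s)) * riemannZeta (s - 1)) - (1 - 2 ^ (1 - s)) * riemannZeta s) := by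
    have : {z : ℂ | -1 < z.re} ∈ 𝓝 (0 : ℂ) :=
      (isOpen_lt continuous_const continuous_re).mem_nhds (by simp)
    filter_upwards [this, isOpen_ne.mem_nhds (zero_ne_one (α := ℂ)),
      isOpen_ne.mem_nhds (two_ne_zero (α := ℂ)).symm] with s hs h1 h2
    exact mul_mellin_exp_neg_mul_one_sub_div_sq hs h1 h2
  rw [hL.unique (hR.congr_of_eventuallyEq heq), deriv_riemannZeta_zero]
  have hl2 : Complex.log 2 = (Real.log 2 : ℂ) := by
    rw [← ofReal_ofNat, ← ofReal_log (by norm_num)]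
  have hl2p : Complex.log (2 * Real.pi) = (Real.log 2 : ℂ) + Real.log Real.pi := by
    rw [← ofReal_ofNat, ← ofReal_mul, ← ofReal_log (by positivity),
      Real.log_mul two_ne_zero Real.pi_ne_zero, ofReal_add]
  simp only [sub_zero, zero_sub, zero_add, hzm1, riemannZeta_zero, Gamma_one, hl2, hl2p,
    cpow_one, cpow_ofNat, Pi.sub_apply, Pi.mul_apply]
  ring

open Set Filter Topology Complex in
lemma integral_exp_mul_I_div_cosh_half (y : ℝ) :
    ∫ u : ℝ, cexp (u * y * I) / (2 * Real.cosh (u / 2) : ℝ) =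
      (Real.pi / Real.cosh (Real.pi * y) : ℝ) := by
  have hs : (0 : ℝ) < (1 / 2 + y * I : ℂ).re := by simp
  have ht : (0 : ℝ) < (1 - (1 / 2 + y * I) : ℂ).re := by simp; norm_num
  have hG := Gamma_mul_Gamma_eq_betaIntegral hs ht
  rw [Gamma_mul_Gamma_one_sub, add_sub_cancel, Gamma_one, one_mul, betaIntegral,
    intervalIntegral.integral_of_le zero_le_one, integral_Ioc_eq_integral_Ioo,
    ← Real.range_sigmoid, ← image_univ, integral_image_eq_integral_abs_deriv_smul
      MeasurableSet.univ (fun x _ ↦ (Real.hasDerivAt_sigmoid x).hasDerivWithinAt)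
      Real.sigmoid_injective.injOn, setIntegral_univ] at hG
  rw [show Real.pi * (1 / 2 + y * I) = Real.pi * y * I + Real.pi / 2 by ring,
    sin_add_pi_div_two, ← ofReal_mul, cos_mul_I, ← ofReal_cosh, ← ofReal_div] at hG
  rw [hG]
  refine integral_congr_ae (Eventually.of_forall fun u ↦ ?_)
  have h0 := Real.sigmoid_pos u
  have h1 := sub_pos.mpr (Real.sigmoid_lt_one u)
  have h2 : 1 - Real.sigmoid u = Real.sigmoid u * Real.exp (-u) := by
    rw [Real.sigmoid_mul_rexp_neg, Real.sigmoid_neg]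
  have hexp : Real.sigmoid u = Real.exp (Real.log (Real.sigmoid u)) := (Real.exp_log h0).symm
  set L := Real.log (Real.sigmoid u)
  have h3 : 1 - Real.sigmoid u = Real.exp (L - u) := by
    rw [h2, sub_eq_add_neg, Real.exp_add, ← hexp]
  have h4 : (2 * Real.cosh (u / 2))⁻¹ = Real.exp (L - u / 2) := by
    rw [Real.exp_sub, ← hexp, Real.sigmoid_def, Real.cosh_eq]
    have : Real.exp (-u) = Real.exp (-(u / 2)) / Real.exp (u / 2) := by
      rw [← Real.exp_sub]; ring_nf
    rw [this]
    have := Real.exp_pos (u / 2)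
    have := Real.exp_pos (-(u / 2))
    field_simp
  have hc (r : ℝ) (z : ℂ) : ((Real.exp r : ℝ) : ℂ) ^ z = cexp (r * z) := by
    rw [cpow_def_of_ne_zero (by simp), ← ofReal_log (Real.exp_pos _).le, Real.log_exp]
  have h5 : (1 : ℂ) - (Real.sigmoid u : ℂ) = ((1 - Real.sigmoid u : ℝ) : ℂ) := by push_cast; rfl
  beta_reduce
  rw [abs_of_pos (mul_pos h0 h1), real_smul, h5, h3, div_eq_mul_inv, ← ofReal_inv, h4, hexp, hc, hc]
  push_cast
  simp only [← Complex.exp_add]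
  congr 1
  ring

open Set Filter Topology Complex in
lemma integral_exp_mul_I_div_cosh_pi_mul (x : ℝ) :
    ∫ v : ℝ, cexp (x * v * I) / Real.cosh (Real.pi * v) = (1 / Real.cosh (x / 2) : ℝ) := by
  have h := Measure.integral_comp_mul_left (fun u : ℝ ↦
    cexp (u * (x / (2 * Real.pi) : ℝ) * I) / (2 * Real.cosh (u / 2) : ℝ)) (2 * Real.pi)
  have hpi := Real.pi_pos
  have hpi' : (Real.pi : ℂ) ≠ 0 := by exact_mod_cast hpi.ne'
  rw [integral_exp_mul_I_div_cosh_half] at h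
  have h1 (v : ℝ) : cexp (x * v * I) / Real.cosh (Real.pi * v) =
      2 * (cexp ((2 * Real.pi * v : ℝ) * (x / (2 * Real.pi) : ℝ) * I) /
        (2 * Real.cosh (2 * Real.pi * v / 2) : ℝ)) := by
    rw [show 2 * Real.pi * v / 2 = Real.pi * v by ring]
    have : (2 * Real.pi * v : ℝ) * (x / (2 * Real.pi) : ℝ) * I = x * v * I := by
      push_cast; field_simp
    have hc : ((Real.cosh (Real.pi * v) : ℝ) : ℂ) ≠ 0 := by
      exact_mod_cast (Real.cosh_pos _).ne'
    rw [this]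
    push_cast at hc ⊢
    field_simp
  simp_rw [h1]
  rw [integral_const_mul, h, abs_of_pos (by positivity), real_smul,
    show Real.pi * (x / (2 * Real.pi)) = x / 2 by field_simp]
  have hc : ((Real.cosh (x / 2) : ℝ) : ℂ) ≠ 0 := by exact_mod_cast (Real.cosh_pos _).ne'
  push_cast at hc ⊢
  field_simp

open Set Filter Topology in
lemma integral_Ioi_cos_mul_div_cosh_pi_mul (x : ℝ) :
    ∫ v in Ioi (0 : ℝ), Real.cos (x * v) / Real.cosh (Real.pi * v) =
      1 / (2 * Real.cosh (x / 2)) := by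
  have h := integral_exp_mul_I_div_cosh_pi_mul x
  have hi : Integrable fun v : ℝ ↦ Complex.exp (x * v * Complex.I) / Real.cosh (Real.pi * v) := by
    refine Integrable.of_integral_ne_zero ?_
    rw [h]
    exact_mod_cast (one_div_pos.mpr (Real.cosh_pos (x / 2))).ne'
  have h1 := Complex.reCLM.integral_comp_comm hi
  rw [h] at h1
  have h2 : ∀ v : ℝ, Complex.reCLM (Complex.exp (x * v * Complex.I) / Real.cosh (Real.pi * v)) =
      Real.cos (x * |v|) / Real.cosh (Real.pi * |v|) := fun v ↦ by
    rw [Complex.reCLM_apply, Complex.div_ofReal_re, ← Complex.ofReal_mul,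
      Complex.exp_ofReal_mul_I_re]
    rcases abs_choice v with hv | hv <;> simp [hv]
  simp_rw [h2] at h1
  rw [integral_comp_abs (f := fun v ↦ Real.cos (x * v) / Real.cosh (Real.pi * v)),
    Complex.reCLM_apply, Complex.ofReal_re] at h1
  have := Real.cosh_pos (x / 2)
  rw [eq_div_iff this.ne'] at h1
  rw [eq_div_iff (by positivity)]
  linarith

open Set Filter Topology in
lemma integrableOn_pow_div_cosh_pi_mul (n : ℕ) :
    IntegrableOn (fun v : ℝ ↦ v ^ n / Real.cosh (Real.pi * v)) (Ioi 0) := by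
  have h := (integrableOn_rpow_mul_exp_neg_mul_rpow (s := n) (p := 1) (b := Real.pi)
    (by have : (0 : ℝ) ≤ n := n.cast_nonneg
        linarith) one_pos Real.pi_pos).const_mul 2
  refine h.mono' ?_ ?_
  · exact (Continuous.div (by fun_prop) (by fun_prop)
      fun v ↦ (Real.cosh_pos _).ne').aestronglyMeasurable
  · filter_upwards [ae_restrict_mem measurableSet_Ioi] with v (hv : 0 < v)
    have h1 := Real.cosh_pos (Real.pi * v)
    rw [Real.norm_of_nonneg (by positivity), Real.rpow_natCast, Real.rpow_one,
      div_le_iff₀ h1, Real.cosh_eq]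
    have h2 : Real.exp (-Real.pi * v) * Real.exp (Real.pi * v) = 1 := by
      rw [← Real.exp_add]; simp
    have h3 := Real.exp_pos (-(Real.pi * v))
    have h4 := Real.exp_pos (-Real.pi * v)
    have h5 : 0 < v ^ n := by positivity
    calc v ^ n = v ^ n * (Real.exp (-Real.pi * v) * Real.exp (Real.pi * v)) := by rw [h2, mul_one]
      _ ≤ v ^ n * (Real.exp (-Real.pi * v) * Real.exp (Real.pi * v))
          + v ^ n * (Real.exp (-Real.pi * v) * Real.exp (-(Real.pi * v))) := by
        have : 0 < v ^ n * (Real.exp (-Real.pi * v) * Real.exp (-(Real.pi * v))) := by positivity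
        linarith
      _ = _ := by ring

open Set Filter Topology in
lemma integral_Ioi_mul_sin_mul_div_cosh_pi_mul (x : ℝ) :
    ∫ v in Ioi (0 : ℝ), v * Real.sin (x * v) / Real.cosh (Real.pi * v) =
      Real.sinh (x / 2) / (4 * Real.cosh (x / 2) ^ 2) := by
  have hc (v : ℝ) : Real.cosh (Real.pi * v) ≠ 0 := (Real.cosh_pos _).ne'
  have h := (hasDerivAt_integral_of_dominated_loc_of_deriv_le (μ := volume.restrict (Ioi (0 : ℝ)))
    (F := fun x v : ℝ ↦ Real.cos (x * v) / Real.cosh (Real.pi * v))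
    (F' := fun x v : ℝ ↦ -(v * Real.sin (x * v) / Real.cosh (Real.pi * v))) (x₀ := x)
    (bound := fun v ↦ v ^ 1 / Real.cosh (Real.pi * v)) (s := univ) univ_mem
    (Eventually.of_forall fun y ↦
      (Continuous.div (by fun_prop) (by fun_prop) hc).aestronglyMeasurable)
    ?_ (Continuous.div (by fun_prop) (by fun_prop) hc).neg.aestronglyMeasurable ?_
    (integrableOn_pow_div_cosh_pi_mul 1) ?_).2
  · have h1 : HasDerivAt (fun y : ℝ ↦ 1 / (2 * Real.cosh (y / 2)))
        (-(Real.sinh (x / 2) / (4 * Real.cosh (x / 2) ^ 2))) x := by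
      have h0 := (Real.cosh_pos (x / 2)).ne'
      have := ((((hasDerivAt_id x).div_const 2).cosh.const_mul 2).inv (by simp [h0]))
      simp only [id, ← one_div] at this
      convert! this using 1
      field_simp
      ring
    simp only [integral_Ioi_cos_mul_div_cosh_pi_mul, integral_neg] at h
    exact neg_injective (h.unique h1)
  · refine (integrableOn_pow_div_cosh_pi_mul 0).mono'
      (Continuous.div (by fun_prop) (by fun_prop) hc).aestronglyMeasurable
      (Eventually.of_forall fun v ↦ ?_)
    have := Real.cosh_pos (Real.pi * v)
    rw [norm_div, Real.norm_of_nonneg this.le, pow_zero]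
    gcongr
    exact Real.abs_cos_le_one _
  · filter_upwards [ae_restrict_mem measurableSet_Ioi] with v (hv : 0 < v) y _
    have := Real.cosh_pos (Real.pi * v)
    rw [norm_neg, norm_div, norm_mul, Real.norm_of_nonneg this.le, Real.norm_of_nonneg hv.le,
      pow_one]
    gcongr
    exact mul_le_of_le_one_right hv.le (Real.abs_sin_le_one _)
  · refine Eventually.of_forall fun v y _ ↦ ?_
    have := ((hasDerivAt_mul_const (x := y) v).cos).div_const (Real.cosh (Real.pi * v))
    convert! this using 1
    ring

lemma norm_sin_mul_div_le (v : ℝ) {x : ℝ} (hx : 0 < x) : ‖Real.sin (v * x) / x‖ ≤ |v| := by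
  rw [norm_div, Real.norm_of_nonneg hx.le, div_le_iff₀ hx]
  calc ‖Real.sin (v * x)‖ ≤ |v * x| := Real.abs_sin_le_abs
    _ = |v| * x := by rw [abs_mul, abs_of_pos hx]

lemma integral_Ioi_exp_neg_half_mul_cos (v : ℝ) :
    ∫ x in Set.Ioi (0 : ℝ), Real.exp (-1 / 2 * x) * Real.cos (v * x) = 2 / (1 + (2 * v) ^ 2) := by
  have ha : (-1 / 2 + v * Complex.I : ℂ).re < 0 := by simp; norm_num
  have h := Complex.reCLM.integral_comp_comm (integrableOn_exp_mul_complex_Ioi ha 0)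
  rw [integral_exp_mul_complex_Ioi ha] at h
  have h1 (x : ℝ) : Complex.reCLM (Complex.exp ((-1 / 2 + v * Complex.I) * x)) =
      Real.exp (-1 / 2 * x) * Real.cos (v * x) := by
    rw [Complex.reCLM_apply, Complex.exp_re]
    simp
  simp_rw [h1] at h
  rw [h]
  simp [Complex.div_re, Complex.normSq_apply]
  field_simp

open Set Filter Topology in
lemma integral_Ioi_exp_neg_half_mul_sin_div (v : ℝ) :
    ∫ x in Ioi (0 : ℝ), Real.exp (-1 / 2 * x) * (Real.sin (v * x) / x) =
      Real.arctan (2 * v) := by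
  have hexp : IntegrableOn (fun x : ℝ ↦ Real.exp (-1 / 2 * x)) (Ioi 0) :=
    integrableOn_exp_mul_Ioi (by norm_num) 0
  have hmeas (v : ℝ) : AEStronglyMeasurable
      (fun x : ℝ ↦ Real.exp (-1 / 2 * x) * (Real.sin (v * x) / x)) (volume.restrict (Ioi 0)) :=
    Measurable.aestronglyMeasurable (by fun_prop)
  have hd (v : ℝ) : HasDerivAt
      (fun v ↦ ∫ x in Ioi (0 : ℝ), Real.exp (-1 / 2 * x) * (Real.sin (v * x) / x))
      (2 / (1 + (2 * v) ^ 2)) v := by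
    rw [← integral_Ioi_exp_neg_half_mul_cos]
    refine (hasDerivAt_integral_of_dominated_loc_of_deriv_le
      (F' := fun v x : ℝ ↦ Real.exp (-1 / 2 * x) * Real.cos (v * x))
      (bound := fun x ↦ Real.exp (-1 / 2 * x)) (s := univ) univ_mem
      (Eventually.of_forall hmeas) ?_ (Continuous.aestronglyMeasurable (by fun_prop)) ?_ hexp ?_).2
    · refine (hexp.mul_const |v|).mono' (hmeas v) ?_
      filter_upwards [ae_restrict_mem measurableSet_Ioi] with x hx
      rw [norm_mul, Real.norm_of_nonneg (Real.exp_pos _).le]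
      gcongr
      exact norm_sin_mul_div_le v hx
    · refine Eventually.of_forall fun x y _ ↦ ?_
      rw [norm_mul, Real.norm_of_nonneg (Real.exp_pos _).le]
      exact mul_le_of_le_one_right (Real.exp_pos _).le (Real.abs_cos_le_one _)
    · filter_upwards [ae_restrict_mem measurableSet_Ioi] with x (hx : 0 < x) y _
      convert! (((hasDerivAt_mul_const (x := y) x).sin).div_const x).const_mul
        (Real.exp (-1 / 2 * x)) using 1
      field_simp
  have ha (v : ℝ) : HasDerivAt (fun v ↦ Real.arctan (2 * v)) (2 / (1 + (2 * v) ^ 2)) v := by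
    convert! ((hasDerivAt_id v).const_mul 2).arctan using 1
    simp
    ring
  have hc := is_const_of_deriv_eq_zero (fun v ↦ ((hd v).sub (ha v)).differentiableAt)
    (fun v ↦ by rw [((hd v).sub (ha v)).deriv, sub_self]) v 0
  simpa [sub_eq_zero] using hc

open Set Filter Topology in
lemma integral_mul_arctan_div_cosh_eq_integral_exp :
    ∫ v in Ioi (0 : ℝ), v * Real.arctan (2 * v) / Real.cosh (Real.pi * v) =
      1 / 2 * ∫ x in Ioi (0 : ℝ), x⁻¹ *
        (Real.exp (-x) * (1 - Real.exp (-x)) / (1 + Real.exp (-x)) ^ 2) := by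
  have hswap := integral_integral_swap (μ := volume.restrict (Ioi (0 : ℝ)))
    (ν := volume.restrict (Ioi (0 : ℝ)))
    (f := fun v x : ℝ ↦ v / Real.cosh (Real.pi * v) *
      (Real.exp (-1 / 2 * x) * (Real.sin (v * x) / x))) ?_
  · calc _ = ∫ v in Ioi (0 : ℝ), ∫ x in Ioi (0 : ℝ), v / Real.cosh (Real.pi * v) *
        (Real.exp (-1 / 2 * x) * (Real.sin (v * x) / x)) := by
          simp_rw [integral_const_mul, integral_Ioi_exp_neg_half_mul_sin_div]
          simp_rw [div_mul_eq_mul_div]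
      _ = ∫ x in Ioi (0 : ℝ), ∫ v in Ioi (0 : ℝ), v / Real.cosh (Real.pi * v) *
        (Real.exp (-1 / 2 * x) * (Real.sin (v * x) / x)) := hswap
      _ = ∫ x in Ioi (0 : ℝ), Real.exp (-1 / 2 * x) / x *
        (Real.sinh (x / 2) / (4 * Real.cosh (x / 2) ^ 2)) := by
          congr 1
          ext x
          rw [← integral_Ioi_mul_sin_mul_div_cosh_pi_mul, ← integral_const_mul]
          congr 1
          ext v
          rw [mul_comm v x]
          ring
      _ = _ := by
          rw [← integral_const_mul]
          congr 1
          ext x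
          have h1 : Real.exp (-1 / 2 * x) = (Real.exp (x / 2))⁻¹ := by
            rw [← Real.exp_neg]; ring_nf
          have h2 : Real.exp (-x) = (Real.exp (x / 2))⁻¹ ^ 2 := by
            rw [← Real.exp_neg, ← Real.exp_nat_mul]; push_cast; ring_nf
          rw [h1, h2, Real.sinh_eq, Real.cosh_eq, Real.exp_neg]
          have := Real.exp_pos (x / 2)
          rcases eq_or_ne x 0 with rfl | hx
          · simp
          · field_simp
            ring
  · have hb := (integrableOn_pow_div_cosh_pi_mul 2).mul_prod
      (integrableOn_exp_mul_Ioi (a := -1 / 2) (by norm_num) 0)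
    refine hb.mono' (Measurable.aestronglyMeasurable ?_) ?_
    · have : Measurable Real.cosh := Real.continuous_cosh.measurable
      fun_prop
    · rw [Measure.prod_restrict]
      filter_upwards [ae_restrict_mem (measurableSet_Ioi.prod measurableSet_Ioi)]
        with ⟨v, x⟩ ⟨hv, hx⟩
      have hv : 0 < v := hv
      have hx : 0 < x := hx
      have h0 := Real.cosh_pos (Real.pi * v)
      simp only [Function.uncurry_apply_pair]
      have h1 := norm_sin_mul_div_le v hx
      rw [abs_of_pos hv] at h1
      rw [norm_mul, norm_mul, Real.norm_of_nonneg (div_pos hv h0).le,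
        Real.norm_of_nonneg (Real.exp_pos _).le]
      calc _ ≤ v / Real.cosh (Real.pi * v) * (Real.exp (-1 / 2 * x) * v) := by gcongr
        _ = _ := by ring

/-- `∫_0^∞ v arctan(2v)/cosh(πv) dv = -log(π)/4 - 1/4 + 3 log A - log(2)/12`,
where `A` is the Glaisher–Kinkelin constant, `log A = 1/12 - ζ'(-1)`.
The identity is stated in `ℂ` since `ζ'(-1)` is a value of the complex
Riemann zeta derivative; its value is real. -/
theorem integral_arctan_two_v :
    (↑(∫ v in Set.Ioi (0 : ℝ), v * Real.arctan (2 * v) / Real.cosh (Real.pi * v)) : ℂ) =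
      -(Real.log Real.pi) / 4 - 1 / 4 +
        3 * ((1 : ℂ) / 12 - deriv riemannZeta (-1)) - (Real.log 2) / 12 := by
  have h := mellin_exp_neg_mul_one_sub_div_sq_zero
  have hm : mellin (fun t : ℝ ↦
      ((Real.exp (-t) * (1 - Real.exp (-t)) / (1 + Real.exp (-t)) ^ 2 : ℝ) : ℂ)) 0 =
      ((∫ x in Set.Ioi (0 : ℝ), x⁻¹ *
        (Real.exp (-x) * (1 - Real.exp (-x)) / (1 + Real.exp (-x)) ^ 2) : ℝ) : ℂ) := by
    rw [mellin, ← integral_complex_ofReal]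
    congr 1
    ext x
    rw [zero_sub, Complex.cpow_neg_one, smul_eq_mul]
    push_cast
    rfl
  rw [integral_mul_arctan_div_cosh_eq_integral_exp, Complex.ofReal_mul, ← hm, h]
  push_cast
  ring
end
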